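/- Suppose 0 < p < ∞ and let f be a continuous function on the unit circle 𝕋 such that f(U) − f(V) ∈ S_p whenever U and V are unitary operators on a separable Hilbert space with rank(U − V) = 1. Then f belongs to the Besov space B_p^{1/p} of the circle. -/

import Mathlib

open scoped BigOperators
noncomputable section

/-- The `j`-th singular value of a bounded operator `T` on a Hilbert space:
`s_j(T) = inf {‖T - R‖ : rank R ≤ j}`. -/
def sVal {H : Type} [NormedAddCommGroup H] [InnerProductSpace ℂ H] [CompleteSpace H]
    (T : H →L[ℂ] H) (j : ℕ) : ℝ :=
  sInf {c : ℝ | ∃ R : H →L[ℂ] H, LinearMap.rank (R : H →ₗ[ℂ] H) ≤ (j : Cardinal) ∧ c = ‖T - R‖}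

/-- Membership in the Schatten–von Neumann class `S_p`. -/
def MemSchatten {H : Type} [NormedAddCommGroup H] [InnerProductSpace ℂ H] [CompleteSpace H]
    (p : ℝ) (T : H →L[ℂ] H) : Prop :=
  Summable fun j : ℕ => sVal T j ^ p

/-- The Schatten–von Neumann norm `‖T‖_{S_p} = (∑_{j ≥ 0} s_j(T)^p)^{1/p}`. -/
def schNorm {H : Type} [NormedAddCommGroup H] [InnerProductSpace ℂ H] [CompleteSpace H]
    (p : ℝ) (T : H →L[ℂ] H) : ℝ :=
  (∑' j : ℕ, sVal T j ^ p) ^ (1 / p)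

/-- `w` is an admissible Littlewood–Paley weight: smooth, nonnegative, supported in `[1/2, 2]`,
with `w(x) = 1 - w(x/2)` on `[1, 2]`. -/
def AdmissibleWeight (w : ℝ → ℝ) : Prop :=
  ContDiff ℝ (⊤ : ℕ∞) w ∧ (∀ x, 0 ≤ w x) ∧ Function.support w ⊆ Set.Icc (1 / 2) 2 ∧
    ∀ x ∈ Set.Icc (1 : ℝ) 2, w x = 1 - w (x / 2)

open MeasureTheory intervalIntegral in
/-- The point `e^{it}` on the unit circle. -/
def ept (t : ℝ) : ℂ := Complex.exp (t * Complex.I)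

/-- The trigonometric polynomial `W_n(z) = ∑_{k ∈ ℤ} w(k/2ⁿ) z^k` for `n ≥ 1`, and
`W_0(z) = z̄ + 1 + z`. -/
def circW (w : ℝ → ℝ) (n : ℕ) (z : ℂ) : ℂ :=
  if n = 0 then (starRingEnd ℂ) z + 1 + z else ∑' k : ℤ, (w ((k : ℝ) / 2 ^ n) : ℂ) * z ^ k

/-- `W_n^♯(z) = conj (W_n(z))`. -/
def circWs (w : ℝ → ℝ) (n : ℕ) (z : ℂ) : ℂ := (starRingEnd ℂ) (circW w n z)

/-- Convolution on the unit circle with respect to normalized Lebesgue measure: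
`(f * g)(ζ) = ∫_𝕋 f(τ) g(ζ τ̄) dm(τ)`. -/
def circConv (f g : ℂ → ℂ) (ζ : ℂ) : ℂ :=
  (2 * Real.pi)⁻¹ • ∫ t in (0 : ℝ)..(2 * Real.pi), f (ept t) * g (ζ * (ept t)⁻¹)

/-- The `p`-th power of the `L^p(𝕋)` norm with respect to normalized Lebesgue measure:
`‖g‖_{L^p(𝕋)}^p = (2π)⁻¹ ∫_0^{2π} ‖g(e^{it})‖^p dt`. -/
def circLpP (p : ℝ) (g : ℂ → ℂ) : ℝ :=
  (2 * Real.pi)⁻¹ * ∫ t in (0 : ℝ)..(2 * Real.pi), ‖g (ept t)‖ ^ p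

/-- Jensen's inequality for `x ↦ x ^ p`, `p ≥ 1`, with weights of total mass at most one. -/
lemma rpow_weighted_sum_le {ι : Type} (s : Finset ι) {p : ℝ} (hp : 1 ≤ p) (a x : ι → ℝ)
    (ha : ∀ i, 0 ≤ a i) (hx : ∀ i, 0 ≤ x i) (hsum : ∑ i ∈ s, a i ≤ 1) :
    (∑ i ∈ s, a i * x i) ^ p ≤ ∑ i ∈ s, a i * x i ^ p := by
  have hp0 : 0 < p := by linarith
  have h := Real.inner_le_weight_mul_Lp_of_nonneg s hp a x ha hx
  have hS : 0 ≤ ∑ i ∈ s, a i * x i ^ p :=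
    Finset.sum_nonneg fun i _ => mul_nonneg (ha i) (Real.rpow_nonneg (hx i) p)
  have h1 : (∑ i ∈ s, a i) ^ (1 - p⁻¹) ≤ 1 :=
    Real.rpow_le_one (Finset.sum_nonneg fun i _ => ha i) hsum
      (sub_nonneg.2 (inv_le_one_of_one_le₀ hp))
  have h2 : ∑ i ∈ s, a i * x i ≤ (∑ i ∈ s, a i * x i ^ p) ^ p⁻¹ :=
    h.trans (mul_le_of_le_one_left (Real.rpow_nonneg hS _) h1)
  calc (∑ i ∈ s, a i * x i) ^ p ≤ ((∑ i ∈ s, a i * x i ^ p) ^ p⁻¹) ^ p :=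
        Real.rpow_le_rpow (Finset.sum_nonneg fun i _ => mul_nonneg (ha i) (hx i)) h2 hp0.le
    _ = _ := Real.rpow_inv_rpow hS hp0.ne'

section Svd

variable {E F : Type} [NormedAddCommGroup E] [InnerProductSpace ℂ E]
  [NormedAddCommGroup F] [InnerProductSpace ℂ F]

/-- Singular value decomposition: an orthonormal basis of the domain whose image is orthogonal,
ordered by decreasing norm of the image. -/
lemma exists_orthonormalBasis_orthogonal_image [FiniteDimensional ℂ E] [CompleteSpace F]
    {n : ℕ} (hn : Module.finrank ℂ E = n) (A : E →L[ℂ] F) :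
    ∃ b : OrthonormalBasis (Fin n) ℂ E,
      (∀ i j, i ≠ j → inner ℂ (A (b i)) (A (b j)) = 0) ∧ Antitone fun i => ‖A (b i)‖ := by
  have : CompleteSpace E := FiniteDimensional.complete ℂ E
  have hS : ((ContinuousLinearMap.adjoint A ∘L A : E →L[ℂ] E) : E →ₗ[ℂ] E).IsSymmetric := by
    intro x y
    simp [ContinuousLinearMap.adjoint_inner_left, ContinuousLinearMap.adjoint_inner_right]
  set b := hS.eigenvectorBasis hn
  have key : ∀ i j, inner ℂ (A (b i)) (A (b j)) =
      (hS.eigenvalues hn j : ℂ) * inner ℂ (b i) (b j) := by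
    intro i j
    have := hS.apply_eigenvectorBasis hn j
    rw [← ContinuousLinearMap.adjoint_inner_right]
    have h2 : ContinuousLinearMap.adjoint A (A (b j)) = (hS.eigenvalues hn j : ℂ) • b j := this
    rw [h2, inner_smul_right]
  refine ⟨b, fun i j hij => ?_, fun i j hij => ?_⟩
  · rw [key, b.inner_eq_zero hij, mul_zero]
  · have hsq : ∀ i, ‖A (b i)‖ ^ 2 = hS.eigenvalues hn i := by
      intro i
      have h := key i i
      rw [inner_self_eq_norm_sq_to_K, inner_self_eq_norm_sq_to_K, b.norm_eq_one] at h
      have h' : ((‖A (b i)‖ ^ 2 : ℝ) : ℂ) = (hS.eigenvalues hn i : ℂ) := by simpa using h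
      exact_mod_cast h'
    refine le_of_sq_le_sq ?_ (norm_nonneg _)
    rw [hsq, hsq]
    exact hS.eigenvalues_antitone hn hij

lemma norm_sq_sum_of_orthogonal {ι : Type} (s : Finset ι) (v : ι → F)
    (hv : ∀ i j, i ≠ j → inner ℂ (v i) (v j) = 0) :
    ‖∑ i ∈ s, v i‖ ^ 2 = ∑ i ∈ s, ‖v i‖ ^ 2 := by
  classical
  induction s using Finset.induction_on with
  | empty => simp
  | insert a s ha ih =>
    rw [Finset.sum_insert ha, Finset.sum_insert ha, ← ih]
    have : inner ℂ (v a) (∑ i ∈ s, v i) = 0 := by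
      rw [inner_sum]
      exact Finset.sum_eq_zero fun i hi => hv a i (by rintro rfl; exact ha hi)
    have h := norm_add_sq_eq_norm_sq_add_norm_sq_of_inner_eq_zero _ _ this
    simpa [sq] using h

/-- If `A` maps `j + 1` orthonormal vectors to orthogonal vectors of norm at least `c`, then `A`
is at distance at least `c` from the operators of rank at most `j`. -/
lemma le_norm_sub_of_orthogonal_image {j : ℕ} (A R : E →L[ℂ] F) (v : Fin (j + 1) → E)
    (hv : Orthonormal ℂ v) (hA : ∀ i k, i ≠ k → inner ℂ (A (v i)) (A (v k)) = 0) (c : ℝ)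
    (hc0 : 0 ≤ c) (hc : ∀ i, c ≤ ‖A (v i)‖)
    (hR : LinearMap.rank (R : E →ₗ[ℂ] F) ≤ (j : Cardinal)) : c ≤ ‖A - R‖ := by
  set L : (Fin (j + 1) → ℂ) →ₗ[ℂ] F := (R : E →ₗ[ℂ] F) ∘ₗ Fintype.linearCombination ℂ v
  have hrank : LinearMap.rank L ≤ (j : Cardinal) := (LinearMap.rank_comp_le_left _ _).trans hR
  have hker : LinearMap.ker L ≠ ⊥ := by
    intro h
    have h1 : LinearMap.rank L = (j + 1 : ℕ) := by
      rw [LinearMap.rank, rank_range_of_injective L (LinearMap.ker_eq_bot.1 h)]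
      simp
    rw [h1] at hrank
    exact absurd (Nat.cast_le.1 hrank) (by omega)
  obtain ⟨a, ha, ha0⟩ := (Submodule.ne_bot_iff _).1 hker
  set x : E := ∑ i, a i • v i
  have hRx : R x = 0 := by
    have : L a = 0 := ha
    simpa [L, Fintype.linearCombination_apply, x] using this
  have hx2 : ‖x‖ ^ 2 = ∑ i, ‖a i‖ ^ 2 := by
    rw [norm_sq_sum_of_orthogonal]
    · exact Finset.sum_congr rfl fun i _ => by rw [norm_smul, hv.1 i, mul_one]
    · intro i k hik
      rw [inner_smul_left, inner_smul_right, hv.2 hik]; simp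
  have hAx2 : ‖A x‖ ^ 2 = ∑ i, ‖a i‖ ^ 2 * ‖A (v i)‖ ^ 2 := by
    simp only [x, map_sum, map_smul]
    rw [norm_sq_sum_of_orthogonal]
    · exact Finset.sum_congr rfl fun i _ => by rw [norm_smul, mul_pow]
    · intro i k hik
      rw [inner_smul_left, inner_smul_right, hA i k hik]; simp
  have hpos : 0 < ‖x‖ := by
    obtain ⟨i, hi⟩ := Function.ne_iff.1 ha0
    have : 0 < ‖x‖ ^ 2 := by
      rw [hx2]
      exact Finset.sum_pos' (fun _ _ => by positivity)
        ⟨i, Finset.mem_univ _, by have : 0 < ‖a i‖ := norm_pos_iff.2 hi; positivity⟩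
    by_contra hcon
    have h0 : ‖x‖ = 0 := le_antisymm (not_lt.1 hcon) (norm_nonneg _)
    rw [h0] at this; norm_num at this
  have hle : c * ‖x‖ ≤ ‖A x‖ := by
    refine le_of_sq_le_sq ?_ (norm_nonneg _)
    rw [mul_pow, hx2, hAx2, Finset.mul_sum]
    refine Finset.sum_le_sum fun i _ => ?_
    rw [mul_comm]
    gcongr
    exact hc i
  have : ‖A x‖ ≤ ‖A - R‖ * ‖x‖ := by
    have := (A - R).le_opNorm x
    simpa [hRx] using this
  exact le_of_mul_le_mul_right (hle.trans this) hpos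

end Svd

section Schatten

/-- The operator from a Euclidean space sending the `i`-th coordinate vector to `u i`. -/
def synthesis {ι H : Type} [Fintype ι] [NormedAddCommGroup H] [InnerProductSpace ℂ H]
    (u : ι → H) : EuclideanSpace ℂ ι →L[ℂ] H :=
  LinearMap.toContinuousLinearMap
    (Fintype.linearCombination ℂ u ∘ₗ (WithLp.linearEquiv 2 ℂ (ι → ℂ)).toLinearMap)

variable {H : Type} [NormedAddCommGroup H] [InnerProductSpace ℂ H]

lemma synthesis_apply {ι : Type} [Fintype ι] (u : ι → H) (x : EuclideanSpace ℂ ι) :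
    synthesis u x = ∑ i, x i • u i := by
  simp [synthesis, Fintype.linearCombination_apply]

lemma synthesis_single {ι : Type} [Fintype ι] [DecidableEq ι] (u : ι → H) (i : ι) :
    synthesis u (EuclideanSpace.single i 1) = u i := by
  rw [synthesis_apply, Finset.sum_eq_single i] <;> simp +contextual

lemma norm_synthesis_le {ι : Type} [Fintype ι] {u : ι → H} (hu : Orthonormal ℂ u) :
    ‖synthesis u‖ ≤ 1 := by
  refine ContinuousLinearMap.opNorm_le_bound _ zero_le_one fun x => ?_
  refine le_of_sq_le_sq ?_ (by positivity)
  rw [synthesis_apply, norm_sq_sum_of_orthogonal, one_mul, EuclideanSpace.norm_sq_eq]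
  · exact (Finset.sum_congr rfl fun i _ => by rw [norm_smul, hu.1 i, mul_one]).le
  · intro i k hik
    rw [inner_smul_left, inner_smul_right, hu.2 hik]; simp

/-- Bessel's inequality for orthogonal vectors in the unit ball. -/
lemma sum_norm_inner_sq_le {ι : Type} [Fintype ι] (g : ι → H)
    (hg : ∀ i j, i ≠ j → inner ℂ (g i) (g j) = 0) (hg1 : ∀ i, ‖g i‖ ≤ 1) (v : H) :
    ∑ i, ‖inner ℂ (g i) v‖ ^ 2 ≤ ‖v‖ ^ 2 := by
  set S := ∑ i, ‖inner ℂ (g i) v‖ ^ 2 with hS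
  set z := ∑ i, inner ℂ (g i) v • g i with hz
  have hS0 : 0 ≤ S := Finset.sum_nonneg fun _ _ => by positivity
  have h1 : ‖z‖ ^ 2 ≤ S := by
    rw [hz, norm_sq_sum_of_orthogonal]
    · refine Finset.sum_le_sum fun i _ => ?_
      rw [norm_smul]
      gcongr
      exact mul_le_of_le_one_right (norm_nonneg _) (hg1 i)
    · intro i k hik
      rw [inner_smul_left, inner_smul_right, hg i k hik]; simp
  have h2 : inner ℂ z v = (S : ℂ) := by
    rw [hz, sum_inner, hS]
    push_cast
    refine Finset.sum_congr rfl fun i _ => ?_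
    rw [inner_smul_left, mul_comm, Complex.mul_conj, Complex.normSq_eq_norm_sq]
    push_cast; rfl
  have h3 : S ≤ ‖z‖ * ‖v‖ := by
    have := norm_inner_le_norm (𝕜 := ℂ) z v
    rwa [h2, Complex.norm_real, Real.norm_of_nonneg hS0] at this
  by_contra hcon
  push Not at hcon
  have h4 : S * S ≤ S * ‖v‖ ^ 2 := by
    calc S * S ≤ (‖z‖ * ‖v‖) * (‖z‖ * ‖v‖) := by gcongr
      _ = ‖z‖ ^ 2 * ‖v‖ ^ 2 := by ring
      _ ≤ S * ‖v‖ ^ 2 := by gcongr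
  nlinarith [sq_nonneg ‖v‖]

variable [CompleteSpace H]

lemma norm_image_le_sVal {E : Type} [NormedAddCommGroup E] [InnerProductSpace ℂ E] {n : ℕ}
    (T : H →L[ℂ] H) (Y : E →L[ℂ] H) (hY : ‖Y‖ ≤ 1) (b : OrthonormalBasis (Fin n) ℂ E)
    (hb : ∀ i j, i ≠ j → inner ℂ ((T ∘L Y) (b i)) ((T ∘L Y) (b j)) = 0)
    (hanti : Antitone fun i => ‖(T ∘L Y) (b i)‖) (i : Fin n) :
    ‖(T ∘L Y) (b i)‖ ≤ sVal T i := by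
  refine le_csInf ⟨_, 0, by simp, rfl⟩ ?_
  rintro _ ⟨R, hR, rfl⟩
  have hlt : (i : ℕ) + 1 ≤ n := i.2
  have h := le_norm_sub_of_orthogonal_image (T ∘L Y) (R ∘L Y) (fun k => b (Fin.castLE hlt k))
    (b.orthonormal.comp _ (Fin.castLE_injective hlt))
    (fun k l hkl => hb _ _ fun h => hkl (Fin.castLE_injective hlt h)) ‖(T ∘L Y) (b i)‖
    (norm_nonneg _) (fun k => hanti (Fin.mk_le_of_le_val (Nat.lt_succ_iff.1 k.2)))
    ((LinearMap.rank_comp_le_left _ _).trans hR)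
  refine h.trans ?_
  rw [← ContinuousLinearMap.sub_comp]
  refine (ContinuousLinearMap.opNorm_comp_le _ _).trans ?_
  exact mul_le_of_le_one_right (norm_nonneg _) hY

lemma sVal_nonneg (T : H →L[ℂ] H) (j : ℕ) : 0 ≤ sVal T j := by
  refine Real.sInf_nonneg ?_
  rintro _ ⟨R, _, rfl⟩
  exact norm_nonneg _

lemma sum_norm_image_rpow_le {E : Type} [NormedAddCommGroup E] [InnerProductSpace ℂ E] {n : ℕ}
    {p : ℝ} (hp : 0 < p) (T : H →L[ℂ] H) (hT : MemSchatten p T)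
    (Y : E →L[ℂ] H) (hY : ‖Y‖ ≤ 1) (b : OrthonormalBasis (Fin n) ℂ E)
    (hb : ∀ i j, i ≠ j → inner ℂ ((T ∘L Y) (b i)) ((T ∘L Y) (b j)) = 0)
    (hanti : Antitone fun i => ‖(T ∘L Y) (b i)‖) :
    ∑ i, ‖(T ∘L Y) (b i)‖ ^ p ≤ ∑' j, sVal T j ^ p := by
  calc ∑ i, ‖(T ∘L Y) (b i)‖ ^ p ≤ ∑ i : Fin n, sVal T i ^ p :=
        Finset.sum_le_sum fun i _ =>
          Real.rpow_le_rpow (norm_nonneg _) (norm_image_le_sVal T Y hY b hb hanti i) hp.le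
    _ = ∑ i ∈ Finset.range n, sVal T i ^ p := Fin.sum_univ_eq_sum_range (fun i => sVal T i ^ p) n
    _ ≤ _ := hT.sum_le_tsum _ fun i _ => Real.rpow_nonneg (sVal_nonneg T i) p

/-- For `p ≥ 1`, diagonal entries with respect to orthonormal systems are controlled by the
Schatten sum. -/
lemma sum_norm_inner_rpow_le {ι : Type} [Fintype ι] {p : ℝ} (hp : 1 ≤ p) (T : H →L[ℂ] H)
    (hT : MemSchatten p T) (u v : ι → H) (hu : Orthonormal ℂ u) (hv : Orthonormal ℂ v) :
    ∑ i, ‖inner ℂ (v i) (T (u i))‖ ^ p ≤ ∑' j, sVal T j ^ p := by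
  classical
  set Y := synthesis u
  obtain ⟨b, hb, hanti⟩ := exists_orthonormalBasis_orthogonal_image rfl (T ∘L Y)
  refine le_trans ?_ (sum_norm_image_rpow_le (by linarith) T hT Y (norm_synthesis_le hu) b hb hanti)
  set A := T ∘L Y with hA
  set g := fun k => ((‖A (b k)‖ : ℂ)⁻¹) • A (b k) with hg
  have hg0 : ∀ k, A (b k) = (‖A (b k)‖ : ℂ) • g k := by
    intro k
    by_cases h : A (b k) = 0
    · simp [hg, h]
    · have : (‖A (b k)‖ : ℂ) ≠ 0 := by simpa using h
      simp only [hg]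
      rw [smul_inv_smul₀ this]
  have hgo : ∀ i j, i ≠ j → inner ℂ (g i) (g j) = 0 := by
    intro i j hij
    simp only [hg]
    rw [inner_smul_left, inner_smul_right, hb i j hij]; simp
  have hg1 : ∀ k, ‖g k‖ ≤ 1 := by
    intro k
    simp only [hg, norm_smul, norm_inv, Complex.norm_real, norm_norm]
    exact inv_mul_le_one
  set e : ι → EuclideanSpace ℂ ι := fun i => EuclideanSpace.single i 1
  set a := fun (i : ι) k => ‖inner ℂ (b k) (e i)‖ * ‖inner ℂ (g k) (v i)‖
  have hcs : ∀ x y : ℝ, x * y ≤ (x ^ 2 + y ^ 2) / 2 := fun x y => by nlinarith [sq_nonneg (x - y)]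
  have hrow : ∀ i, ∑ k, a i k ≤ 1 := by
    intro i
    have h1 := sum_norm_inner_sq_le g hgo hg1 (v i)
    have h2 := b.sum_sq_norm_inner_right (e i)
    have h3 : ‖e i‖ = 1 := by simp [e]
    rw [hv.1 i] at h1
    rw [h3] at h2
    calc ∑ k, a i k ≤ ∑ k, (‖inner ℂ (b k) (e i)‖ ^ 2 + ‖inner ℂ (g k) (v i)‖ ^ 2) / 2 :=
          Finset.sum_le_sum fun k _ => hcs _ _
      _ ≤ 1 := by rw [← Finset.sum_div, Finset.sum_add_distrib]; linarith
  have hcol : ∀ k, ∑ i, a i k ≤ 1 := by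
    intro k
    have h1 : ∑ i, ‖inner ℂ (b k) (e i)‖ ^ 2 = 1 := by
      have h := (EuclideanSpace.basisFun ι ℂ).sum_sq_norm_inner_left (b k)
      rw [b.norm_eq_one] at h
      simpa [e, EuclideanSpace.basisFun_apply] using h
    have h2 := hv.sum_inner_products_le (s := Finset.univ) (g k)
    have h3 : ‖g k‖ ^ 2 ≤ 1 := pow_le_one₀ (norm_nonneg _) (hg1 k)
    calc ∑ i, a i k ≤ ∑ i, (‖inner ℂ (b k) (e i)‖ ^ 2 + ‖inner ℂ (v i) (g k)‖ ^ 2) / 2 :=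
          Finset.sum_le_sum fun i _ => by
            rw [norm_inner_symm (v i)]; exact hcs _ _
      _ ≤ 1 := by rw [← Finset.sum_div, Finset.sum_add_distrib]; linarith
  have hentry : ∀ i, ‖inner ℂ (v i) (T (u i))‖ ≤ ∑ k, a i k * ‖A (b k)‖ := by
    intro i
    have h1 : T (u i) = A (e i) := by
      simp only [hA, e, ContinuousLinearMap.comp_apply, Y, synthesis_single]
    have h2 : A (e i) = ∑ k, inner ℂ (b k) (e i) • A (b k) := by
      conv_lhs => rw [← b.sum_repr' (e i)]
      simp
    rw [h1, h2, inner_sum]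
    refine (norm_sum_le _ _).trans (Finset.sum_le_sum fun k _ => ?_)
    conv_lhs => rw [hg0 k]
    rw [inner_smul_right, inner_smul_right, norm_mul, norm_mul, Complex.norm_real, norm_norm,
      norm_inner_symm]
    simp only [a]
    rw [norm_inner_symm (v i)]
    exact le_of_eq (by rw [norm_inner_symm (e i)]; ring)
  calc ∑ i, ‖inner ℂ (v i) (T (u i))‖ ^ p
      ≤ ∑ i, ∑ k, a i k * ‖A (b k)‖ ^ p := by
        refine Finset.sum_le_sum fun i _ => ?_
        exact (Real.rpow_le_rpow (norm_nonneg _) (hentry i) (by linarith)).trans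
          (rpow_weighted_sum_le _ hp _ _ (fun k => by positivity) (fun k => norm_nonneg _) (hrow i))
    _ = ∑ k, (∑ i, a i k) * ‖A (b k)‖ ^ p := by
        rw [Finset.sum_comm]; simp_rw [Finset.sum_mul]
    _ ≤ ∑ k, ‖A (b k)‖ ^ p := Finset.sum_le_sum fun k _ =>
        mul_le_of_le_one_left (by positivity) (hcol k)

end Schatten

section Factorization

/-- For `q ≤ 2`, the `q`-th powers of the column norms control the `q`-th powers of the distances
to finite rank operators, which are realised by composing with self-adjoint finite rank
operators. -/
lemma exists_rank_approx {ι F : Type} [Fintype ι] [DecidableEq ι] [NormedAddCommGroup F]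
    [InnerProductSpace ℂ F] [CompleteSpace F] {q : ℝ} (hq : 0 < q) (hq2 : q ≤ 2)
    (A : EuclideanSpace ℂ ι →L[ℂ] F) :
    ∃ σ : ℕ → ℝ, (∀ j, 0 ≤ σ j) ∧
      (∀ N, ∑ j ∈ Finset.range N, σ j ^ q ≤ ∑ i, ‖A (EuclideanSpace.single i 1)‖ ^ q) ∧
      ∀ j : ℕ, ∃ P : EuclideanSpace ℂ ι →L[ℂ] EuclideanSpace ℂ ι,
        LinearMap.rank (P : EuclideanSpace ℂ ι →ₗ[ℂ] EuclideanSpace ℂ ι) ≤ (j : Cardinal) ∧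
        ContinuousLinearMap.adjoint P = P ∧ ‖A - A ∘L P‖ ≤ σ j := by
  obtain ⟨n, hn⟩ : ∃ n, Module.finrank ℂ (EuclideanSpace ℂ ι) = n := ⟨_, rfl⟩
  obtain ⟨b, hb, hanti⟩ := exists_orthonormalBasis_orthogonal_image hn A
  set e : ι → EuclideanSpace ℂ ι := fun i => EuclideanSpace.single i 1 with he
  have hAx : ∀ x, A x = ∑ k, inner ℂ (b k) x • A (b k) := by
    intro x
    conv_lhs => rw [← b.sum_repr' x]
    simp
  have horth : ∀ c : Fin n → ℂ, ∀ i j, i ≠ j → inner ℂ (c i • A (b i)) (c j • A (b j)) = 0 := by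
    intro c i j hij
    rw [inner_smul_left, inner_smul_right, hb i j hij]; simp
  refine ⟨fun j => if h : j < n then ‖A (b ⟨j, h⟩)‖ else 0, fun j => by dsimp only; split_ifs <;> simp,
    fun N => ?_, fun j => ?_⟩
  · have h1 : ∑ j ∈ Finset.range N, (if h : j < n then ‖A (b ⟨j, h⟩)‖ else 0) ^ q ≤
        ∑ k : Fin n, ‖A (b k)‖ ^ q := by
      have h2 : ∑ k : Fin n, ‖A (b k)‖ ^ q =
          ∑ j ∈ Finset.range n, (if h : j < n then ‖A (b ⟨j, h⟩)‖ else 0) ^ q := by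
        rw [← Fin.sum_univ_eq_sum_range (fun j => (if h : j < n then ‖A (b ⟨j, h⟩)‖ else 0) ^ q)]
        exact Finset.sum_congr rfl fun k _ => by simp
      rw [h2]
      rcases le_total N n with hN | hN
      · exact Finset.sum_le_sum_of_subset_of_nonneg (Finset.range_mono hN) fun j _ _ => by
          split_ifs <;> positivity
      · refine le_of_eq (Finset.sum_subset (Finset.range_mono hN) fun j _ hj => ?_).symm
        simp only [Finset.mem_range] at hj
        rw [dif_neg hj, Real.zero_rpow hq.ne']
    refine h1.trans ?_
    have hcol : ∀ k, ∑ i, ‖inner ℂ (b k) (e i)‖ ^ 2 = 1 := by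
      intro k
      have h := (EuclideanSpace.basisFun ι ℂ).sum_sq_norm_inner_left (b k)
      rw [b.norm_eq_one] at h
      simpa [e, EuclideanSpace.basisFun_apply] using h
    have hrow : ∀ i, ∑ k, ‖inner ℂ (b k) (e i)‖ ^ 2 = 1 := by
      intro i
      have h := b.sum_sq_norm_inner_right (e i)
      rw [h]; simp [e]
    have hi : ∀ i, ∑ k, ‖inner ℂ (b k) (e i)‖ ^ 2 * ‖A (b k)‖ ^ q ≤ ‖A (e i)‖ ^ q := by
      intro i
      have h := rpow_weighted_sum_le Finset.univ (p := 2 / q) (by rw [le_div_iff₀ hq]; linarith)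
        (fun k => ‖inner ℂ (b k) (e i)‖ ^ 2) (fun k => ‖A (b k)‖ ^ q) (fun k => by positivity)
        (fun k => by positivity) (hrow i).le
      have h3 : ‖A (e i)‖ ^ 2 = ∑ k, ‖inner ℂ (b k) (e i)‖ ^ 2 * (‖A (b k)‖ ^ q) ^ (2 / q) := by
        rw [hAx (e i), norm_sq_sum_of_orthogonal _ _ (horth _)]
        refine Finset.sum_congr rfl fun k _ => ?_
        rw [norm_smul, mul_pow, ← Real.rpow_mul (norm_nonneg _), mul_div_cancel₀ _ hq.ne']
        norm_num
      rw [← h3] at h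
      have h4 := Real.rpow_le_rpow (by positivity) h (by positivity : 0 ≤ q / 2)
      rw [← Real.rpow_mul (by positivity), ← Real.rpow_natCast, ← Real.rpow_mul (norm_nonneg _)] at h4
      have h5 : 2 / q * (q / 2) = 1 := by field_simp
      have h6 : ((2 : ℕ) : ℝ) * (q / 2) = q := by push_cast; ring
      rwa [h5, h6, Real.rpow_one] at h4
    calc ∑ k, ‖A (b k)‖ ^ q = ∑ k, (∑ i, ‖inner ℂ (b k) (e i)‖ ^ 2) * ‖A (b k)‖ ^ q := by
          simp_rw [hcol, one_mul]
      _ = ∑ i, ∑ k, ‖inner ℂ (b k) (e i)‖ ^ 2 * ‖A (b k)‖ ^ q := by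
          simp_rw [Finset.sum_mul]; rw [Finset.sum_comm]
      _ ≤ _ := Finset.sum_le_sum fun i _ => hi i
  · set s : Finset (Fin n) := Finset.univ.filter fun k => (k : ℕ) < j with hs
    set P : EuclideanSpace ℂ ι →L[ℂ] EuclideanSpace ℂ ι :=
      ∑ k ∈ s, (innerSL ℂ (b k)).smulRight (b k) with hP
    have hPx : ∀ x, P x = ∑ k ∈ s, inner ℂ (b k) x • b k := by
      intro x
      simp [hP]
    refine ⟨P, ?_, ?_, ?_⟩
    · have hrange : LinearMap.range (P : EuclideanSpace ℂ ι →ₗ[ℂ] EuclideanSpace ℂ ι) ≤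
          Submodule.span ℂ ((s.image b : Finset _) : Set (EuclideanSpace ℂ ι)) := by
        rintro _ ⟨x, rfl⟩
        change P x ∈ _
        rw [hPx]
        refine Submodule.sum_mem _ fun k hk => Submodule.smul_mem _ _ (Submodule.subset_span ?_)
        exact Finset.mem_coe.2 (Finset.mem_image_of_mem _ hk)
      refine (Submodule.rank_mono hrange).trans ((rank_span_finset_le _).trans ?_)
      refine Nat.cast_le.2 (Finset.card_image_le.trans ?_)
      have : s.card = (s.image fun k : Fin n => (k : ℕ)).card :=
        (Finset.card_image_of_injective _ Fin.val_injective).symm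
      rw [this]
      refine (Finset.card_le_card (t := Finset.range j) fun m hm => ?_).trans (by simp)
      obtain ⟨k, hk, rfl⟩ := Finset.mem_image.1 hm
      simpa [hs] using hk
    · symm
      rw [ContinuousLinearMap.eq_adjoint_iff]
      intro x y
      rw [hPx, hPx, sum_inner, inner_sum]
      refine Finset.sum_congr rfl fun k _ => ?_
      rw [inner_smul_left, inner_smul_right, inner_conj_symm]
      ring
    · refine ContinuousLinearMap.opNorm_le_bound _ (by dsimp only; split_ifs <;> simp) fun x => ?_
      refine le_of_sq_le_sq ?_ (mul_nonneg (by dsimp only; split_ifs <;> simp) (norm_nonneg _))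
      have hx : (A - A ∘L P) x = ∑ k, (if k ∈ s then 0 else inner ℂ (b k) x) • A (b k) := by
        simp only [sub_apply, ContinuousLinearMap.comp_apply]
        rw [hPx, map_sum, hAx x, ← Finset.sum_filter_add_sum_filter_not Finset.univ (· ∈ s)]
        simp only [map_smul, Finset.filter_univ_mem, add_sub_cancel_left]
        rw [Finset.sum_filter]
        refine Finset.sum_congr rfl fun k _ => ?_
        by_cases hk : k ∈ s <;> simp [hk]
      rw [hx, norm_sq_sum_of_orthogonal _ _ (horth _), mul_pow, ← b.sum_sq_norm_inner_right x,
        Finset.mul_sum]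
      refine Finset.sum_le_sum fun k _ => ?_
      by_cases hk : k ∈ s
      · simp only [hk, if_true, zero_smul, norm_zero]
        rw [zero_pow two_ne_zero]
        exact mul_nonneg (sq_nonneg _) (sq_nonneg _)
      · have hkj : j ≤ (k : ℕ) := by simpa [hs] using hk
        have hjn : j < n := lt_of_le_of_lt hkj k.2
        dsimp only
        rw [if_neg hk, dif_pos hjn, norm_smul, mul_pow, mul_comm]
        gcongr
        exact hanti (Fin.mk_le_of_le_val hkj)

lemma sum_range_div_two_le (h : ℕ → ℝ) (h0 : ∀ j, 0 ≤ h j) (N : ℕ) :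
    ∑ i ∈ Finset.range N, h (i / 2) ≤ 2 * ∑ j ∈ Finset.range N, h j := by
  have key : ∀ n, ∑ i ∈ Finset.range (2 * n), h (i / 2) = 2 * ∑ j ∈ Finset.range n, h j := by
    intro n
    induction n with
    | zero => simp
    | succ n ih =>
      rw [show 2 * (n + 1) = 2 * n + 1 + 1 by ring, Finset.sum_range_succ, Finset.sum_range_succ, ih,
        Finset.sum_range_succ, show (2 * n) / 2 = n by omega, show (2 * n + 1) / 2 = n by omega]
      ring
  rw [← key]
  exact Finset.sum_le_sum_of_subset_of_nonneg (Finset.range_mono (by omega)) fun i _ _ => h0 _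

/-- If `X Z†` maps an orthonormal family to an orthogonal one, then the norms of the images are
controlled, for `p ≤ 1`, by the column norms of `X` and `Z`. -/
lemma sum_norm_image_factorization_le {ι κ α I : Type} [Fintype ι] [Fintype κ] [Fintype α]
    [DecidableEq α] [Fintype I] {p : ℝ} (hp : 0 < p) (hp1 : p ≤ 1)
    (X : EuclideanSpace ℂ α →L[ℂ] EuclideanSpace ℂ ι)
    (Z : EuclideanSpace ℂ α →L[ℂ] EuclideanSpace ℂ κ)
    (u : I → EuclideanSpace ℂ κ) (hu : Orthonormal ℂ u)
    (hD : ∀ i j, i ≠ j → inner ℂ ((X ∘L ContinuousLinearMap.adjoint Z) (u i))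
      ((X ∘L ContinuousLinearMap.adjoint Z) (u j)) = 0) :
    ∑ i, ‖(X ∘L ContinuousLinearMap.adjoint Z) (u i)‖ ^ p ≤
      ∑ a, ‖X (EuclideanSpace.single a 1)‖ ^ (2 * p) +
        ∑ a, ‖Z (EuclideanSpace.single a 1)‖ ^ (2 * p) := by
  set D := X ∘L ContinuousLinearMap.adjoint Z with hDdef
  obtain ⟨σ, hσ0, hσ, hσP⟩ := exists_rank_approx (q := 2 * p) (by linarith) (by linarith) X
  obtain ⟨τ, hτ0, hτ, hτP⟩ := exists_rank_approx (q := 2 * p) (by linarith) (by linarith) Z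
  set N := Fintype.card I
  set f : Fin N → ℝ := fun i => -‖D (u ((Fintype.equivFin I).symm i))‖ with hf
  set e : Fin N ≃ I := (Tuple.sort f).trans (Fintype.equivFin I).symm with he
  have hmono : Antitone fun i => ‖D (u (e i))‖ := by
    intro i j hij
    have := Tuple.monotone_sort f hij
    simpa [hf, he] using this
  have hbound : ∀ i : Fin N, ‖D (u (e i))‖ ≤ σ ((i : ℕ) / 2) * τ ((i : ℕ) / 2) := by
    intro i
    obtain ⟨P, hPr, -, hP⟩ := hσP ((i : ℕ) / 2)
    obtain ⟨Q, hQr, hQa, hQ⟩ := hτP ((i : ℕ) / 2)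
    set Za := ContinuousLinearMap.adjoint Z
    set R := (X ∘L P) ∘L (Za - Q ∘L Za) + X ∘L (Q ∘L Za) with hR
    have hfac : D - R = (X - X ∘L P) ∘L (Za - Q ∘L Za) := by
      rw [hDdef, hR]
      ext1 x
      simp only [sub_apply, add_apply,
        ContinuousLinearMap.comp_apply, map_sub]
      abel
    have hrank : LinearMap.rank (R : EuclideanSpace ℂ κ →ₗ[ℂ] EuclideanSpace ℂ ι) ≤
        ((i : ℕ) : Cardinal) := by
      have h1 : LinearMap.rank (((X ∘L P) ∘L (Za - Q ∘L Za) :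
          EuclideanSpace ℂ κ →L[ℂ] EuclideanSpace ℂ ι) :
          EuclideanSpace ℂ κ →ₗ[ℂ] EuclideanSpace ℂ ι) ≤ (((i : ℕ) / 2 : ℕ) : Cardinal) :=
        (LinearMap.rank_comp_le_left _ _).trans ((LinearMap.rank_comp_le_right _ _).trans hPr)
      have h2 : LinearMap.rank ((X ∘L (Q ∘L Za) :
          EuclideanSpace ℂ κ →L[ℂ] EuclideanSpace ℂ ι) :
          EuclideanSpace ℂ κ →ₗ[ℂ] EuclideanSpace ℂ ι) ≤ (((i : ℕ) / 2 : ℕ) : Cardinal) :=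
        (LinearMap.rank_comp_le_right _ _).trans ((LinearMap.rank_comp_le_left _ _).trans hQr)
      refine (LinearMap.rank_add_le _ _).trans ((add_le_add h1 h2).trans ?_)
      rw [← Nat.cast_add]
      exact Nat.cast_le.2 (by omega)
    have hlt : (i : ℕ) + 1 ≤ N := i.2
    have h := le_norm_sub_of_orthogonal_image D R (fun k => u (e (Fin.castLE hlt k)))
      (hu.comp _ (e.injective.comp (Fin.castLE_injective hlt)))
      (fun k l hkl => hD _ _ fun h => hkl (Fin.castLE_injective hlt (e.injective h)))
      ‖D (u (e i))‖ (norm_nonneg _)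
      (fun k => hmono (Fin.mk_le_of_le_val (Nat.lt_succ_iff.1 k.2))) hrank
    refine h.trans ?_
    rw [hfac]
    refine (ContinuousLinearMap.opNorm_comp_le _ _).trans ?_
    have hZ : ‖Za - Q ∘L Za‖ ≤ τ ((i : ℕ) / 2) := by
      have : Za - Q ∘L Za = ContinuousLinearMap.adjoint (Z - Z ∘L Q) := by
        rw [map_sub, ContinuousLinearMap.adjoint_comp, hQa]
      rw [this, LinearIsometryEquiv.norm_map]
      exact hQ
    exact mul_le_mul hP hZ (norm_nonneg _) (hσ0 _)
  have hterm : ∀ j, (σ j * τ j) ^ p ≤ (σ j ^ (2 * p) + τ j ^ (2 * p)) / 2 := by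
    intro j
    rw [Real.mul_rpow (hσ0 j) (hτ0 j), mul_comm 2 p, Real.rpow_mul (hσ0 j), Real.rpow_mul (hτ0 j)]
    norm_num
    nlinarith [sq_nonneg (σ j ^ p - τ j ^ p)]
  calc ∑ i, ‖D (u i)‖ ^ p = ∑ i : Fin N, ‖D (u (e i))‖ ^ p :=
        (Equiv.sum_comp e fun i => ‖D (u i)‖ ^ p).symm
    _ ≤ ∑ i : Fin N, (σ ((i : ℕ) / 2) * τ ((i : ℕ) / 2)) ^ p :=
        Finset.sum_le_sum fun i _ => Real.rpow_le_rpow (norm_nonneg _) (hbound i) hp.le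
    _ = ∑ i ∈ Finset.range N, (σ (i / 2) * τ (i / 2)) ^ p :=
        Fin.sum_univ_eq_sum_range (fun i => (σ (i / 2) * τ (i / 2)) ^ p) N
    _ ≤ 2 * ∑ j ∈ Finset.range N, (σ j * τ j) ^ p :=
        sum_range_div_two_le (fun j => (σ j * τ j) ^ p)
          (fun j => Real.rpow_nonneg (mul_nonneg (hσ0 j) (hτ0 j)) p) N
    _ ≤ 2 * ∑ j ∈ Finset.range N, (σ j ^ (2 * p) + τ j ^ (2 * p)) / 2 := by
        gcongr with j _; exact hterm j
    _ = ∑ j ∈ Finset.range N, σ j ^ (2 * p) + ∑ j ∈ Finset.range N, τ j ^ (2 * p) := by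
        rw [← Finset.sum_div, Finset.sum_add_distrib]; ring
    _ ≤ _ := add_le_add (hσ N) (hτ N)

end Factorization

section Weight

namespace AdmissibleWeight

lemma eq_zero_of_le {w : ℝ → ℝ} (hw : AdmissibleWeight w) {x : ℝ} (hx : x ≤ 1 / 2) : w x = 0 := by
  have hlt : ∀ y < (1 / 2 : ℝ), w y = 0 := fun y hy => by
    by_contra h
    exact absurd (hw.2.2.1 h).1 (not_le.2 hy)
  have hc : Continuous w := hw.1.continuous
  have h1 : closure (Set.Iio (1 / 2 : ℝ)) ⊆ {y | w y = 0} :=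
    closure_minimal hlt (isClosed_eq hc continuous_const)
  rw [closure_Iio] at h1
  exact h1 hx

lemma eq_zero_of_ge {w : ℝ → ℝ} (hw : AdmissibleWeight w) {x : ℝ} (hx : 2 ≤ x) : w x = 0 := by
  have hlt : ∀ y > (2 : ℝ), w y = 0 := fun y hy => by
    by_contra h
    exact absurd (hw.2.2.1 h).2 (not_le.2 hy)
  have hc : Continuous w := hw.1.continuous
  have h1 : closure (Set.Ioi (2 : ℝ)) ⊆ {y | w y = 0} :=
    closure_minimal hlt (isClosed_eq hc continuous_const)
  rw [closure_Ioi] at h1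
  exact h1 hx

lemma le_one {w : ℝ → ℝ} (hw : AdmissibleWeight w) (x : ℝ) : w x ≤ 1 := by
  rcases le_total x (1 / 2) with h | h
  · rw [hw.eq_zero_of_le h]; exact zero_le_one
  rcases le_total 2 x with h2 | h2
  · rw [hw.eq_zero_of_ge h2]; exact zero_le_one
  rcases le_total 1 x with h1 | h1
  · linarith [hw.2.2.2 x ⟨h1, h2⟩, hw.2.1 (x / 2)]
  · have := hw.2.2.2 (2 * x) ⟨by linarith, by linarith⟩
    rw [mul_div_cancel_left₀ _ two_ne_zero] at this
    linarith [hw.2.1 (2 * x)]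

lemma eq_zero_of_nat_le {w : ℝ → ℝ} (hw : AdmissibleWeight w) {m l : ℕ} (h : 2 * l ≤ 2 ^ m) :
    w ((l : ℝ) / 2 ^ m) = 0 := by
  refine hw.eq_zero_of_le ?_
  rw [div_le_iff₀ (by positivity)]
  have : (2 * l : ℝ) ≤ 2 ^ m := by exact_mod_cast h
  linarith

lemma eq_zero_of_nat_ge {w : ℝ → ℝ} (hw : AdmissibleWeight w) {m l : ℕ} (h : 2 ^ (m + 1) ≤ l) :
    w ((l : ℝ) / 2 ^ m) = 0 := by
  refine hw.eq_zero_of_ge ?_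
  rw [le_div_iff₀ (by positivity)]
  have : (2 ^ (m + 1) : ℝ) ≤ l := by exact_mod_cast h
  rw [pow_succ] at this
  linarith

/-- The dilates of the weight form a partition of unity. -/
lemma sum_Ico_eq_one {w : ℝ → ℝ} (hw : AdmissibleWeight w) {t l : ℕ} (h1 : 2 ^ t ≤ l)
    (h2 : l < 2 ^ (t + 5)) : ∑ m ∈ Finset.Ico t (t + 6), w ((l : ℝ) / 2 ^ m) = 1 := by
  have hl : l ≠ 0 := by have := Nat.one_le_two_pow (n := t); omega
  set i := Nat.log 2 l with hi
  have hi1 : 2 ^ i ≤ l := Nat.pow_log_le_self 2 hl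
  have hi2 : l < 2 ^ (i + 1) := Nat.lt_pow_succ_log_self one_lt_two l
  have hti : t ≤ i := Nat.le_log_of_pow_le one_lt_two h1
  have hit : i < t + 5 := Nat.log_lt_of_lt_pow hl h2
  have hsub : ({i, i + 1} : Finset ℕ) ⊆ Finset.Ico t (t + 6) := by
    intro m hm
    simp only [Finset.mem_insert, Finset.mem_singleton] at hm
    rw [Finset.mem_Ico]; omega
  rw [← Finset.sum_subset hsub, Finset.sum_pair (by omega)]
  · have hx := hw.2.2.2 ((l : ℝ) / 2 ^ i) ⟨by
      rw [le_div_iff₀ (by positivity), one_mul]; exact_mod_cast hi1, by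
      rw [div_le_iff₀ (by positivity), ← pow_succ']; exact_mod_cast hi2.le⟩
    rw [pow_succ, ← div_div]
    linarith
  · intro m _ hm
    simp only [Finset.mem_insert, Finset.mem_singleton, not_or] at hm
    rcases lt_or_gt_of_ne hm.1 with h | h
    · exact hw.eq_zero_of_nat_ge ((Nat.pow_le_pow_right two_pos h).trans hi1)
    · have : 2 ^ (i + 2) ≤ 2 ^ m := Nat.pow_le_pow_right two_pos (by omega)
      exact hw.eq_zero_of_nat_le (by rw [pow_succ] at this; omega)

end AdmissibleWeight

/-- The dyadic piece `∑ l, w(l/2^m) γ(l) z^l`. -/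
def dyadicPiece (w : ℝ → ℝ) (γ : ℕ → ℂ) (m : ℕ) (z : ℂ) : ℂ :=
  ∑ l ∈ Finset.range (2 ^ (m + 1)), (w ((l : ℝ) / 2 ^ m) : ℂ) * γ l * z ^ l

lemma continuous_dyadicPiece (w : ℝ → ℝ) (γ : ℕ → ℂ) (m : ℕ) :
    Continuous (dyadicPiece w γ m) := by
  unfold dyadicPiece
  fun_prop

lemma sum_eq_dyadicPiece {w : ℝ → ℝ} (hw : AdmissibleWeight w) (γ : ℕ → ℂ) {s j : ℕ}
    (hj : j < 2 ^ (s + 1)) (z : ℂ) :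
    ∑ k ∈ Finset.Ico (2 ^ (s + 1)) (2 ^ (s + 4)),
      (w (((j + k : ℕ) : ℝ) / 2 ^ (s + 3)) : ℂ) * γ (j + k) * z ^ (j + k) =
      dyadicPiece w γ (s + 3) z := by
  set g : ℕ → ℂ := fun l => (w ((l : ℝ) / 2 ^ (s + 3)) : ℂ) * γ l * z ^ l with hg
  have h1 : 2 ^ (s + 2) = 2 * 2 ^ (s + 1) := by ring
  have h3 : 2 ^ (s + 3) = 4 * 2 ^ (s + 1) := by ring
  have h4 : 2 ^ (s + 4) = 8 * 2 ^ (s + 1) := by ring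
  have e1 : ∑ k ∈ Finset.Ico (2 ^ (s + 1)) (2 ^ (s + 4)), g (j + k) =
      ∑ l ∈ Finset.Ico (2 ^ (s + 1) + j) (2 ^ (s + 4) + j), g l := by
    rw [← Finset.sum_Ico_add' g]
    exact Finset.sum_congr rfl fun k _ => by rw [add_comm]
  change ∑ k ∈ Finset.Ico (2 ^ (s + 1)) (2 ^ (s + 4)), g (j + k) = ∑ l ∈ Finset.range _, g l
  rw [e1]
  have hz1 : ∀ l, l < 2 ^ (s + 1) + j → g l = 0 := fun l hl => by
    simp only [hg]
    rw [hw.eq_zero_of_nat_le (by omega)]; simp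
  have hz2 : ∀ l, 2 ^ (s + 4) ≤ l → g l = 0 := fun l hl => by
    simp only [hg]
    rw [hw.eq_zero_of_nat_ge (by omega)]; simp
  have e2 : ∑ l ∈ Finset.Ico (2 ^ (s + 1) + j) (2 ^ (s + 4) + j), g l =
      ∑ l ∈ Finset.range (2 ^ (s + 4) + j), g l := by
    refine Finset.sum_subset (fun l hl => ?_) fun l hl hl' => ?_
    · simp only [Finset.mem_Ico, Finset.mem_range] at hl ⊢; omega
    · simp only [Finset.mem_Ico, Finset.mem_range] at hl hl'
      exact hz1 l (by omega)
  rw [e2]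
  symm
  refine Finset.sum_subset (fun l hl => ?_) fun l hl hl' => ?_
  · simp only [Finset.mem_range] at hl ⊢; omega
  · simp only [Finset.mem_range] at hl'
    exact hz2 l (by omega)

end Weight

section Roots

lemma ept_add (a b : ℝ) : ept (a + b) = ept a * ept b := by
  simp [ept, add_mul, Complex.exp_add]

lemma norm_ept (t : ℝ) : ‖ept t‖ = 1 := Complex.norm_exp_ofReal_mul_I t

lemma continuous_ept : Continuous ept := by unfold ept; fun_prop

lemma ept_two_pi : ept (2 * Real.pi) = 1 := by
  simp [ept, Complex.exp_two_pi_mul_I]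

/-- The points `e^{iθ}` times the `n`-th roots of unity. -/
def rot (n : ℕ) (θ : ℝ) (r : ℕ) : ℂ := ept (θ + r * (2 * Real.pi / n))

lemma norm_rot (n : ℕ) (θ : ℝ) (r : ℕ) : ‖rot n θ r‖ = 1 := norm_ept _

lemma rot_eq (n : ℕ) (θ : ℝ) (r : ℕ) :
    rot n θ r = ept θ * Complex.exp (2 * Real.pi * Complex.I / n) ^ r := by
  rw [rot, ept_add, ← Complex.exp_nat_mul]
  congr 1
  rw [ept]
  push_cast
  ring_nf

lemma ept_ne_zero (t : ℝ) : ept t ≠ 0 := Complex.exp_ne_zero _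

lemma sum_Ico_pow_eq_zero {ξ : ℂ} {n : ℕ} (h1 : ξ ≠ 1) (hn : ξ ^ n = 1) (a c : ℕ) :
    ∑ k ∈ Finset.Ico a (a + c * n), ξ ^ k = 0 := by
  rw [Finset.sum_Ico_eq_sum_range]
  simp only [pow_add, ← Finset.mul_sum, add_tsub_cancel_left]
  rw [geom_sum_eq h1, mul_comm c n, pow_mul, hn]
  simp

lemma conj_rot_mul_rot_pow (n : ℕ) (hn : n ≠ 0) (θ : ℝ) (r r' : ℕ) :
    ((starRingEnd ℂ) (rot n θ r) * rot n θ r') ^ n = 1 := by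
  have h : ∀ r, rot n θ r ^ n = ept θ ^ n := fun r => by
    rw [rot_eq, mul_pow, ← pow_mul, mul_comm r n, pow_mul,
      (Complex.isPrimitiveRoot_exp n hn).pow_eq_one, one_pow, mul_one]
  rw [mul_pow, ← map_pow, h, h, ← Complex.normSq_eq_conj_mul_self, Complex.normSq_eq_norm_sq,
    norm_pow, norm_ept]
  simp

lemma conj_rot_mul_rot_ne_one {n : ℕ} (hn : n ≠ 0) (θ : ℝ) {r r' : ℕ} (hr : r < n) (hr' : r' < n)
    (h : r ≠ r') : (starRingEnd ℂ) (rot n θ r) * rot n θ r' ≠ 1 := by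
  intro he
  have h1 : rot n θ r = rot n θ r' := by
    have h2 : rot n θ r * (starRingEnd ℂ) (rot n θ r) = 1 := by
      rw [Complex.mul_conj, Complex.normSq_eq_norm_sq, norm_rot]; simp
    calc rot n θ r = rot n θ r * ((starRingEnd ℂ) (rot n θ r) * rot n θ r') := by rw [he, mul_one]
      _ = rot n θ r' := by rw [← mul_assoc, h2, one_mul]
  rw [rot_eq, rot_eq] at h1
  exact h ((Complex.isPrimitiveRoot_exp n hn).pow_inj hr hr' (mul_left_cancel₀ (ept_ne_zero θ) h1))

/-- Monomial vectors at rotated roots of unity are orthogonal over intervals whose length is a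
multiple of the order. -/
lemma sum_Ico_conj_rot_mul_rot {n : ℕ} (hn : n ≠ 0) (θ : ℝ) {r r' : ℕ} (hr : r < n) (hr' : r' < n)
    (h : r ≠ r') (a c : ℕ) :
    ∑ k ∈ Finset.Ico a (a + c * n), (starRingEnd ℂ) (rot n θ r ^ k) * rot n θ r' ^ k = 0 := by
  rw [← sum_Ico_pow_eq_zero (conj_rot_mul_rot_ne_one hn θ hr hr' h)
    (conj_rot_mul_rot_pow n hn θ r r') a c]
  exact Finset.sum_congr rfl fun k _ => by rw [map_pow, mul_pow]

/-- Sampling at rotated roots of unity recovers the coefficients of a polynomial. -/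
lemma sum_rot_mul_conj_pow {L : ℕ} (hL : L ≠ 0) (θ : ℝ) (g : ℕ → ℂ) {l : ℕ} (hl : l < L) :
    ∑ r ∈ Finset.range L, (∑ i ∈ Finset.range L, g i * rot L θ r ^ i) *
      (starRingEnd ℂ) (rot L θ r ^ l) = L * g l := by
  set ω := Complex.exp (2 * Real.pi * Complex.I / L)
  have hω : IsPrimitiveRoot ω L := Complex.isPrimitiveRoot_exp L hL
  have hω1 : ‖ω‖ = 1 := hω.norm'_eq_one hL
  have hcω : (starRingEnd ℂ) ω * ω = 1 := by
    rw [← Complex.normSq_eq_conj_mul_self, Complex.normSq_eq_norm_sq, hω1]; simp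
  have hcL : (starRingEnd ℂ) ω ^ L = 1 := by rw [← map_pow, hω.pow_eq_one, map_one]
  have key : ∀ i < L, ∑ r ∈ Finset.range L, rot L θ r ^ i * (starRingEnd ℂ) (rot L θ r ^ l) =
      if i = l then (L : ℂ) else 0 := by
    intro i hi
    split_ifs with h
    · subst h
      rw [Finset.sum_congr rfl (g := fun _ => (1 : ℂ))]
      · simp
      · intro r _
        rw [Complex.mul_conj, Complex.normSq_eq_norm_sq, norm_pow, norm_rot]; simp
    · have e : ∀ r, rot L θ r ^ i * (starRingEnd ℂ) (rot L θ r ^ l) =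
          (ept θ ^ i * (starRingEnd ℂ) (ept θ) ^ l) * (ω ^ i * (starRingEnd ℂ) ω ^ l) ^ r := by
        intro r
        rw [rot_eq, map_pow, map_mul, map_pow]
        ring
      simp_rw [e]
      rw [← Finset.mul_sum, geom_sum_eq, mul_pow, ← pow_mul, ← pow_mul, mul_comm i, mul_comm l,
        pow_mul, pow_mul, hω.pow_eq_one, hcL]
      · simp
      · intro h1
        apply h
        refine hω.pow_inj hi hl ?_
        calc ω ^ i = ω ^ i * ((starRingEnd ℂ) ω * ω) ^ l := by rw [hcω]; simp
          _ = (ω ^ i * (starRingEnd ℂ) ω ^ l) * ω ^ l := by rw [mul_pow]; ring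
          _ = ω ^ l := by rw [h1, one_mul]
  simp_rw [Finset.sum_mul]
  rw [Finset.sum_comm]
  calc ∑ i ∈ Finset.range L, ∑ r ∈ Finset.range L,
        g i * rot L θ r ^ i * (starRingEnd ℂ) (rot L θ r ^ l)
      = ∑ i ∈ Finset.range L, g i * (if i = l then (L : ℂ) else 0) := by
        refine Finset.sum_congr rfl fun i hi => ?_
        rw [← key i (Finset.mem_range.1 hi), Finset.mul_sum]
        exact Finset.sum_congr rfl fun r _ => by ring
    _ = L * g l := by
        simp [Finset.sum_ite_eq', hl, mul_comm]

/-- The coefficients of a symbol are recovered from samples of its dyadic pieces. -/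
lemma sum_rot_dyadicPiece {w : ℝ → ℝ} (hw : AdmissibleWeight w) (γ : ℕ → ℂ) (θ : ℝ) {t l : ℕ}
    (h1 : 2 ^ t ≤ l) (h2 : l < 2 ^ (t + 5)) :
    ∑ r ∈ Finset.range (2 ^ (t + 6)), (∑ m ∈ Finset.Ico t (t + 6),
      dyadicPiece w γ m (rot (2 ^ (t + 6)) θ r)) *
      (starRingEnd ℂ) (rot (2 ^ (t + 6)) θ r ^ l) = 2 ^ (t + 6) * γ l := by
  have h3 : l < 2 ^ (t + 6) := h2.trans (Nat.pow_lt_pow_right one_lt_two (by omega))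
  have e : ∀ z, ∑ m ∈ Finset.Ico t (t + 6), dyadicPiece w γ m z =
      ∑ i ∈ Finset.range (2 ^ (t + 6)),
        ((∑ m ∈ Finset.Ico t (t + 6), w ((i : ℝ) / 2 ^ m) : ℝ) : ℂ) * γ i * z ^ i := by
    intro z
    calc ∑ m ∈ Finset.Ico t (t + 6), dyadicPiece w γ m z
        = ∑ m ∈ Finset.Ico t (t + 6), ∑ i ∈ Finset.range (2 ^ (t + 6)),
          (w ((i : ℝ) / 2 ^ m) : ℂ) * γ i * z ^ i := by
          refine Finset.sum_congr rfl fun m hm => Finset.sum_subset ?_ fun i _ hi => ?_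
          · rw [Finset.mem_Ico] at hm
            exact Finset.range_mono (Nat.pow_le_pow_right two_pos (by omega))
          · rw [hw.eq_zero_of_nat_ge (by simpa using hi)]; simp
      _ = _ := by
          rw [Finset.sum_comm]
          refine Finset.sum_congr rfl fun i _ => ?_
          rw [Complex.ofReal_sum, Finset.sum_mul, Finset.sum_mul]
  simp_rw [e]
  have := sum_rot_mul_conj_pow (L := 2 ^ (t + 6)) (by positivity) θ
    (fun i => ((∑ m ∈ Finset.Ico t (t + 6), w ((i : ℝ) / 2 ^ m) : ℝ) : ℂ) * γ i) h3
  rw [hw.sum_Ico_eq_one h1 h2] at this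
  simpa using this

end Roots

section Multiplier

open scoped SchwartzMap FourierTransform

lemma ept_pow (t : ℝ) (n : ℕ) : ept t ^ n = ept (n * t) := by
  rw [ept, ept, ← Complex.exp_nat_mul]
  push_cast
  ring_nf

/-- The weight expands, on a window around its support, into an exponential series with
coefficients that are `p`-summable for every `p > 0`. -/
lemma AdmissibleWeight.exists_expansion {w : ℝ → ℝ} (hw : AdmissibleWeight w) :
    ∃ c : ℤ → ℂ, (∀ p : ℝ, 0 < p → Summable fun q => ‖c q‖ ^ p) ∧
      ∀ s l : ℕ, 0 < l → l < 20 * 2 ^ s →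
        HasSum (fun q : ℤ => c q * ept (q * (2 * Real.pi) / 2 ^ (s + 4)) ^ l)
          (w ((l : ℝ) / 2 ^ (s + 3)) : ℂ) := by
  obtain ⟨g, hg⟩ : ∃ g : ℝ → ℂ, g = fun x => (w (2 * x) : ℂ) := ⟨_, rfl⟩
  have hgsm : ContDiff ℝ (⊤ : ℕ∞) g :=
    hg ▸ Complex.ofRealCLM.contDiff.comp (hw.1.comp (contDiff_const.mul contDiff_id))
  have hz1 : ∀ x : ℝ, x ≤ 1 / 4 → g x = 0 := fun x hx => by
    simp only [hg]; rw [hw.eq_zero_of_le (by linarith)]; simp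
  have hz2 : ∀ x : ℝ, 1 ≤ x → g x = 0 := fun x hx => by
    simp only [hg]; rw [hw.eq_zero_of_ge (by linarith)]; simp
  have hgc : HasCompactSupport g := by
    refine HasCompactSupport.of_support_subset_isCompact (isCompact_Icc (a := (1 / 4 : ℝ)) (b := 1))
      fun x hx => ⟨?_, ?_⟩
    · by_contra h; exact hx (hz1 x (not_le.1 h).le)
    · by_contra h; exact hx (hz2 x (not_le.1 h).le)
  obtain ⟨G, hGg⟩ : ∃ G : 𝓢(ℝ, ℂ), ∀ x, G x = g x := ⟨hgc.toSchwartzMap hgsm, fun x => rfl⟩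
  have hdecay : ∀ p : ℝ, 0 < p → Summable fun q : ℤ => ‖(𝓕 G) (q : ℝ)‖ ^ p := by
    intro p hp
    have h1 := (((𝓕 G).isBigO_cocompact_rpow (-(2 / p))).comp_tendsto
      Int.tendsto_coe_cofinite).norm_left
    have h2 := h1.rpow hp.le (Filter.Eventually.of_forall fun q => by
      simp only [Function.comp_apply, Pi.zero_apply]; positivity)
    refine summable_of_isBigO (Real.summable_abs_int_rpow one_lt_two) (h2.congr_right ?_)
    intro q
    simp only [Function.comp_apply, Real.norm_eq_abs]
    rw [← Real.rpow_mul (abs_nonneg _)]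
    congr 1
    field_simp
  obtain ⟨c, hc⟩ : ∃ c : ℤ → ℂ, ∀ q, c q = (𝓕 G) (q : ℝ) := ⟨_, fun _ => rfl⟩
  simp_rw [← hc] at hdecay
  refine ⟨c, hdecay, fun s l hl0 hl => ?_⟩
  set x : ℝ := (l : ℝ) / 2 ^ (s + 4) with hx
  have hx0 : 0 < x := by positivity
  have hx1 : x < 5 / 4 := by
    rw [hx, div_lt_iff₀ (by positivity)]
    have : (l : ℝ) < 20 * 2 ^ s := by exact_mod_cast hl
    rw [pow_add]; linarith
  have hterm : ∀ q : ℤ, c q * fourier q (x : UnitAddCircle) =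
      c q * ept (q * (2 * Real.pi) / 2 ^ (s + 4)) ^ l := by
    intro q
    rw [fourier_coe_apply, ept_pow, ept]
    congr 2
    rw [hx]
    push_cast
    ring
  have hsum : Summable fun q : ℤ => c q * ept (q * (2 * Real.pi) / 2 ^ (s + 4)) ^ l := by
    refine Summable.of_norm ?_
    have := hdecay 1 one_pos
    simpa [norm_ept] using this
  have hP := G.tsum_eq_tsum_fourier x
  simp_rw [← hc] at hP
  have hL : ∑' n : ℤ, G (x + n) = (w ((l : ℝ) / 2 ^ (s + 3)) : ℂ) := by
    rw [tsum_eq_single 0]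
    · rw [hGg, hg, hx]
      have : 2 * ((l : ℝ) / 2 ^ (s + 4) + 0) = l / 2 ^ (s + 3) := by
        rw [pow_succ _ (s + 3)]; field_simp; ring
      push_cast
      rw [this]
    · intro n hn
      rw [hGg]
      rcases lt_or_gt_of_ne hn with h | h
      · have : (n : ℝ) ≤ -1 := by exact_mod_cast Int.le_sub_one_of_lt h
        exact hz1 _ (by linarith)
      · have : (1 : ℝ) ≤ n := by exact_mod_cast h
        exact hz2 _ (by linarith)
  rw [hL] at hP
  rw [hP]
  simp_rw [hterm]
  exact hsum.hasSum

end Multiplier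

section Blocks

variable {H : Type} [NormedAddCommGroup H] [InnerProductSpace ℂ H]

lemma inner_sum_smul_sum_smul {κ : Type} [DecidableEq κ] {y : κ → H} (hy : Orthonormal ℂ y)
    (B B' : Finset κ) (β β' : κ → ℂ) :
    inner ℂ (∑ k ∈ B, β k • y k) (∑ k ∈ B', β' k • y k) =
      ∑ k ∈ B ∩ B', (starRingEnd ℂ) (β k) * β' k := by
  simp only [sum_inner, inner_sum, inner_smul_left, inner_smul_right,
    orthonormal_iff_ite.1 hy]
  rw [Finset.inter_comm, ← Finset.filter_mem_eq_inter, Finset.sum_filter]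
  refine Finset.sum_congr rfl fun k _ => ?_
  simp [mul_comm]

/-- Normalised unimodular combinations over finite sets are orthonormal as soon as the coefficient
functions are orthogonal on common parts. -/
lemma orthonormal_unimodular_sum {κ I : Type} [DecidableEq κ] {y : κ → H} (hy : Orthonormal ℂ y)
    (B : I → Finset κ) (hB : ∀ i, (B i).Nonempty) (β : I → κ → ℂ) (hβ : ∀ i k, ‖β i k‖ = 1)
    (h : ∀ i i', i ≠ i' → ∑ k ∈ B i ∩ B i', (starRingEnd ℂ) (β i k) * β i' k = 0) :
    Orthonormal ℂ fun i => (((Real.sqrt (B i).card)⁻¹ : ℝ) : ℂ) • ∑ k ∈ B i, β i k • y k := by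
  have hinner : ∀ i i', inner ℂ (∑ k ∈ B i, β i k • y k) (∑ k ∈ B i', β i' k • y k) =
      ∑ k ∈ B i ∩ B i', (starRingEnd ℂ) (β i k) * β i' k := fun i i' =>
    inner_sum_smul_sum_smul hy _ _ _ _
  refine ⟨fun i => ?_, fun i i' hi => ?_⟩
  · have h1 : ‖∑ k ∈ B i, β i k • y k‖ ^ 2 = (B i).card := by
      have := hinner i i
      rw [inner_self_eq_norm_sq_to_K, Finset.inter_self,
        Finset.sum_congr rfl (g := fun _ => (1 : ℂ))] at this
      · simp only [Finset.sum_const, nsmul_eq_mul, mul_one] at this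
        exact Complex.ofReal_injective (by simpa using this)
      · intro k _
        rw [← Complex.normSq_eq_conj_mul_self, Complex.normSq_eq_norm_sq, hβ]; simp
    have hc : (0 : ℝ) < (B i).card := by exact_mod_cast (hB i).card_pos
    have h2 : ‖∑ k ∈ B i, β i k • y k‖ = Real.sqrt (B i).card := by
      rw [← h1, Real.sqrt_sq (norm_nonneg _)]
    rw [norm_smul, h2, Complex.norm_real, norm_inv, Real.norm_of_nonneg (Real.sqrt_nonneg _)]
    exact inv_mul_cancel₀ (Real.sqrt_pos.2 hc).ne'
  · change inner ℂ _ _ = 0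
    rw [inner_smul_left, inner_smul_right, hinner, h i i' hi]
    simp

/-- The index intervals `[2^s, 2^(s+1))`. -/
def rowBlock (s : ℕ) : Finset ℕ := Finset.Ico (2 ^ s) (2 ^ (s + 1))

/-- The index intervals `[2^(s+1), 2^(s+4))`. -/
def colBlock (s : ℕ) : Finset ℕ := Finset.Ico (2 ^ (s + 1)) (2 ^ (s + 4))

lemma card_rowBlock (s : ℕ) : (rowBlock s).card = 2 ^ s := by
  rw [rowBlock, Nat.card_Ico, pow_succ]; omega

lemma card_colBlock (s : ℕ) : (colBlock s).card = 14 * 2 ^ s := by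
  rw [colBlock, Nat.card_Ico, pow_succ, pow_add]; omega

lemma rowBlock_eq (s : ℕ) : rowBlock s = Finset.Ico (2 ^ s) (2 ^ s + 1 * 2 ^ s) := by
  rw [rowBlock, pow_succ]; congr 1; ring

lemma colBlock_eq (s : ℕ) : colBlock s = Finset.Ico (2 ^ (s + 1)) (2 ^ (s + 1) + 14 * 2 ^ s) := by
  rw [colBlock]; congr 1; ring

/-- Exponents with pairwise gaps at least four. -/
def Separated (S : Finset ℕ) : Prop := ∀ s ∈ S, ∀ t ∈ S, s < t → s + 4 ≤ t

lemma disjoint_rowBlock {s t : ℕ} (h : s ≠ t) : Disjoint (rowBlock s) (rowBlock t) := by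
  rw [Finset.disjoint_left]
  intro k hk hk'
  simp only [rowBlock, Finset.mem_Ico] at hk hk'
  rcases lt_or_gt_of_ne h with h | h
  · have : 2 ^ (s + 1) ≤ 2 ^ t := Nat.pow_le_pow_right two_pos h
    omega
  · have : 2 ^ (t + 1) ≤ 2 ^ s := Nat.pow_le_pow_right two_pos h
    omega

lemma disjoint_colBlock {s t : ℕ} (h : s + 4 ≤ t) : Disjoint (colBlock s) (colBlock t) := by
  rw [Finset.disjoint_left]
  intro k hk hk'
  simp only [colBlock, Finset.mem_Ico] at hk hk'
  have : 2 ^ (s + 4) ≤ 2 ^ (t + 1) := Nat.pow_le_pow_right two_pos (by omega)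
  omega

lemma Separated.disjoint_colBlock {S : Finset ℕ} (hS : Separated S) {s t : ℕ} (hs : s ∈ S)
    (ht : t ∈ S) (h : s ≠ t) : Disjoint (colBlock s) (colBlock t) := by
  rcases lt_or_gt_of_ne h with h | h
  · exact _root_.disjoint_colBlock (hS _ hs _ ht h)
  · exact (_root_.disjoint_colBlock (hS _ ht _ hs h)).symm

/-- Pairs of an exponent `s ∈ S` and a root of unity of order `2^s`. -/
abbrev BlockIndex (S : Finset ℕ) : Type := Σ s : S, Fin (2 ^ (s : ℕ))

lemma sum_blockIndex (S : Finset ℕ) (g : ℕ → ℕ → ℝ) :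
    ∑ i : BlockIndex S, g i.1 i.2 = ∑ s ∈ S, ∑ r ∈ Finset.range (2 ^ s), g s r := by
  rw [Fintype.sum_sigma, ← Finset.sum_coe_sort S]
  exact Finset.sum_congr rfl fun s _ => Fin.sum_univ_eq_sum_range (g s) _

lemma rot_mul_ept (n : ℕ) (θ φ : ℝ) (r : ℕ) : rot n θ r * ept φ = rot n (θ + φ) r := by
  rw [rot, rot, ← ept_add]; congr 1; ring

lemma sum_rowBlock_conj_rot (s : ℕ) (θ : ℝ) {r r' : ℕ} (hr : r < 2 ^ s) (hr' : r' < 2 ^ s)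
    (h : r ≠ r') :
    ∑ k ∈ rowBlock s, (starRingEnd ℂ) (rot (2 ^ s) θ r ^ k) * rot (2 ^ s) θ r' ^ k = 0 := by
  rw [rowBlock_eq]
  exact sum_Ico_conj_rot_mul_rot (by positivity) θ hr hr' h _ _

lemma sum_colBlock_conj_rot (s : ℕ) (θ : ℝ) {r r' : ℕ} (hr : r < 2 ^ s) (hr' : r' < 2 ^ s)
    (h : r ≠ r') :
    ∑ k ∈ colBlock s, (starRingEnd ℂ) (rot (2 ^ s) θ r ^ k) * rot (2 ^ s) θ r' ^ k = 0 := by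
  rw [colBlock_eq]
  exact sum_Ico_conj_rot_mul_rot (by positivity) θ hr hr' h _ _

/-- Averages of Hankel sums over a block, twisted by a modulation, sum up to a dyadic piece. -/
lemma hasSum_dyadicPiece {w : ℝ → ℝ} (hw : AdmissibleWeight w) {c : ℤ → ℂ}
    (hc : ∀ s l : ℕ, 0 < l → l < 20 * 2 ^ s →
        HasSum (fun q : ℤ => c q * ept (q * (2 * Real.pi) / 2 ^ (s + 4)) ^ l)
          (w ((l : ℝ) / 2 ^ (s + 3)) : ℂ)) (γ : ℕ → ℂ) (s : ℕ) (z : ℂ) :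
    HasSum (fun q : ℤ => c q * ((2 ^ s : ℂ)⁻¹ * ∑ j ∈ rowBlock s, ∑ k ∈ colBlock s,
      γ (j + k) * (z * ept (q * (2 * Real.pi) / 2 ^ (s + 4))) ^ (j + k)))
      (dyadicPiece w γ (s + 3) z) := by
  have h1 : HasSum (fun q : ℤ => (2 ^ s : ℂ)⁻¹ * ∑ j ∈ rowBlock s, ∑ k ∈ colBlock s,
      (c q * ept (q * (2 * Real.pi) / 2 ^ (s + 4)) ^ (j + k)) * (γ (j + k) * z ^ (j + k)))
      ((2 ^ s : ℂ)⁻¹ * ∑ j ∈ rowBlock s, ∑ k ∈ colBlock s,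
        (w (((j + k : ℕ) : ℝ) / 2 ^ (s + 3)) : ℂ) * (γ (j + k) * z ^ (j + k))) := by
    refine HasSum.mul_left _ (hasSum_sum fun j hj => hasSum_sum fun k hk => ?_)
    refine HasSum.mul_right _ (hc s (j + k) ?_ ?_)
    · simp only [rowBlock, Finset.mem_Ico] at hj
      have := Nat.one_le_two_pow (n := s)
      omega
    · simp only [rowBlock, colBlock, Finset.mem_Ico] at hj hk
      rw [pow_succ] at hj
      rw [pow_add 2 s 4] at hk
      omega
  have h2 : (2 ^ s : ℂ)⁻¹ * ∑ j ∈ rowBlock s, ∑ k ∈ colBlock s,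
        (w (((j + k : ℕ) : ℝ) / 2 ^ (s + 3)) : ℂ) * (γ (j + k) * z ^ (j + k)) =
        dyadicPiece w γ (s + 3) z := by
    rw [Finset.sum_congr rfl (g := fun _ => dyadicPiece w γ (s + 3) z)]
    · rw [Finset.sum_const, card_rowBlock, nsmul_eq_mul]
      push_cast
      rw [inv_mul_cancel_left₀ (pow_ne_zero _ two_ne_zero)]
    · intro j hj
      simp only [rowBlock, Finset.mem_Ico] at hj
      rw [← sum_eq_dyadicPiece hw γ hj.2 z]
      exact Finset.sum_congr rfl fun k _ => by ring
  rw [h2] at h1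
  convert h1 using 2 with q
  rw [mul_left_comm, Finset.mul_sum]
  congr 1
  refine Finset.sum_congr rfl fun j _ => ?_
  rw [Finset.mul_sum]
  refine Finset.sum_congr rfl fun k _ => ?_
  rw [mul_pow]
  ring

end Blocks

section LargeExponent

variable {H : Type} [NormedAddCommGroup H] [InnerProductSpace ℂ H] [CompleteSpace H]

lemma sum_inter_blocks_eq_zero {κ : Type} [DecidableEq κ] {S : Finset ℕ} (B : ℕ → Finset κ)
    (hB : ∀ s ∈ S, ∀ t ∈ S, s ≠ t → Disjoint (B s) (B t)) (β : BlockIndex S → κ → ℂ)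
    (hβ : ∀ (s : S) (r r' : Fin (2 ^ (s : ℕ))), r ≠ r' →
      ∑ k ∈ B s, (starRingEnd ℂ) (β ⟨s, r⟩ k) * β ⟨s, r'⟩ k = 0)
    (i i' : BlockIndex S) (h : i ≠ i') :
    ∑ k ∈ B i.1 ∩ B i'.1, (starRingEnd ℂ) (β i k) * β i' k = 0 := by
  obtain ⟨s, r⟩ := i
  obtain ⟨t, r'⟩ := i'
  by_cases hst : s = t
  · subst hst
    rw [Finset.inter_self]
    exact hβ s r r' fun hr => h (by rw [hr])
  · have hd := hB s s.2 t t.2 fun h => hst (Subtype.ext h)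
    rw [Finset.disjoint_iff_inter_eq_empty.1 hd, Finset.sum_empty]

/-- For `p ≥ 1`, modulated block averages of a Hankel symbol are controlled by the singular
values. -/
lemma sum_norm_block_average_rpow_le {p : ℝ} (hp : 1 ≤ p) (T : H →L[ℂ] H) (hT : MemSchatten p T)
    {x y : ℕ → H} (hx : Orthonormal ℂ x) (hy : Orthonormal ℂ y) {γ : ℕ → ℂ}
    (hγ : ∀ j k, 1 ≤ j → 1 ≤ k → inner ℂ (x j) (T (y k)) = γ (j + k)) {S : Finset ℕ}
    (hS : Separated S) (θ : ℕ → ℝ) :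
    ∑ i : BlockIndex S, ‖(2 ^ (i.1 : ℕ) : ℂ)⁻¹ * ∑ j ∈ rowBlock i.1, ∑ k ∈ colBlock i.1,
      γ (j + k) * rot (2 ^ (i.1 : ℕ)) (θ i.1) i.2 ^ (j + k)‖ ^ p ≤
      Real.sqrt 14 ^ p * ∑' j, sVal T j ^ p := by
  set ξ : BlockIndex S → ℂ := fun i => rot (2 ^ (i.1 : ℕ)) (θ i.1) i.2 with hξ
  have hξ1 : ∀ i, ‖ξ i‖ = 1 := fun i => norm_rot _ _ _
  have hY := orthonormal_unimodular_sum hy (fun i : BlockIndex S => colBlock i.1)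
    (fun i => Finset.card_pos.1 (by rw [card_colBlock]; positivity)) (fun i k => ξ i ^ k)
    (fun i k => by rw [norm_pow, hξ1, one_pow])
    (sum_inter_blocks_eq_zero colBlock (fun s hs t ht h => hS.disjoint_colBlock hs ht h) _
      fun s r r' h => sum_colBlock_conj_rot s (θ s) r.2 r'.2 fun h' => h (Fin.ext h'))
  have hX := orthonormal_unimodular_sum hx (fun i : BlockIndex S => rowBlock i.1)
    (fun i => Finset.card_pos.1 (by rw [card_rowBlock]; positivity))
    (fun i k => (starRingEnd ℂ) (ξ i ^ k))
    (fun i k => by rw [RCLike.norm_conj, norm_pow, hξ1, one_pow])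
    (sum_inter_blocks_eq_zero rowBlock (fun s _ t _ h => disjoint_rowBlock h) _
      fun s r r' h => by
        have := sum_rowBlock_conj_rot s (θ s) r.2 r'.2 fun h' => h (Fin.ext h')
        rw [← map_zero (starRingEnd ℂ), ← this, map_sum]
        refine Finset.sum_congr rfl fun k _ => ?_
        rw [map_mul, hξ])
  have key := sum_norm_inner_rpow_le hp T hT _ _ hY hX
  have h14 : 0 < Real.sqrt 14 := Real.sqrt_pos.2 (by norm_num)
  calc _ = ∑ i : BlockIndex S, Real.sqrt 14 ^ p * ‖inner ℂ
        ((((Real.sqrt (rowBlock i.1).card)⁻¹ : ℝ) : ℂ) • ∑ k ∈ rowBlock i.1,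
          (starRingEnd ℂ) (ξ i ^ k) • x k)
        (T ((((Real.sqrt (colBlock i.1).card)⁻¹ : ℝ) : ℂ) • ∑ k ∈ colBlock i.1, ξ i ^ k • y k))‖
          ^ p := by
        refine Finset.sum_congr rfl fun i _ => ?_
        rw [← Real.mul_rpow h14.le (norm_nonneg _)]
        congr 1
        have e : inner ℂ (∑ j ∈ rowBlock i.1, (starRingEnd ℂ) (ξ i ^ j) • x j)
            (T (∑ k ∈ colBlock i.1, ξ i ^ k • y k)) =
            ∑ j ∈ rowBlock i.1, ∑ k ∈ colBlock i.1, γ (j + k) * ξ i ^ (j + k) := by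
          rw [map_sum, sum_inner]
          refine Finset.sum_congr rfl fun j hj => ?_
          rw [inner_sum]
          refine Finset.sum_congr rfl fun k hk => ?_
          simp only [rowBlock, colBlock, Finset.mem_Ico] at hj hk
          have h1 := Nat.one_le_two_pow (n := (i.1 : ℕ))
          have h2 := Nat.one_le_two_pow (n := (i.1 : ℕ) + 1)
          rw [map_smul, inner_smul_left, inner_smul_right, hγ j k (by omega) (by omega),
            Complex.conj_conj, pow_add]
          ring
        rw [map_smul, inner_smul_left, inner_smul_right, e, norm_mul, norm_mul, norm_mul,
          card_rowBlock, card_colBlock, Complex.conj_ofReal, Complex.norm_real, Complex.norm_real]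
        push_cast
        rw [Real.sqrt_mul (by norm_num), norm_inv, norm_inv, norm_inv, norm_mul,
          Real.norm_of_nonneg (Real.sqrt_nonneg _), Real.norm_of_nonneg (Real.sqrt_nonneg _),
          norm_pow, Complex.norm_ofNat]
        have h2 : (2 : ℝ) ^ (i.1 : ℕ) = Real.sqrt (2 ^ (i.1 : ℕ)) * Real.sqrt (2 ^ (i.1 : ℕ)) :=
          (Real.mul_self_sqrt (by positivity)).symm
        have h3 : 0 < Real.sqrt (2 ^ (i.1 : ℕ)) := Real.sqrt_pos.2 (by positivity)
        conv_lhs => rw [h2]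
        field_simp
        rfl
    _ ≤ _ := by
        rw [← Finset.mul_sum]
        exact mul_le_mul_of_nonneg_left key (by positivity)

/-- For `p ≥ 1`, the samples of the dyadic pieces of a Hankel symbol are controlled by the singular
values. -/
lemma sum_samples_le_of_one_le {w : ℝ → ℝ} (hw : AdmissibleWeight w) {p : ℝ} (hp : 1 ≤ p)
    (T : H →L[ℂ] H) (hT : MemSchatten p T) {x y : ℕ → H} (hx : Orthonormal ℂ x)
    (hy : Orthonormal ℂ y) {γ : ℕ → ℂ}
    (hγ : ∀ j k, 1 ≤ j → 1 ≤ k → inner ℂ (x j) (T (y k)) = γ (j + k)) :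
    ∃ C : ℝ, ∀ S : Finset ℕ, Separated S → ∀ θ : ℝ,
      ∑ s ∈ S, ∑ r ∈ Finset.range (2 ^ s), ‖dyadicPiece w γ (s + 3) (rot (2 ^ s) θ r)‖ ^ p ≤ C := by
  obtain ⟨c, hcsum, hc⟩ := hw.exists_expansion
  have hc1 : Summable fun q => ‖c q‖ := by simpa using hcsum 1 one_pos
  set σ : ℝ := ∑' q, ‖c q‖ + 1 with hσ
  have hσ0 : 0 < σ := add_pos_of_nonneg_of_pos (tsum_nonneg fun _ => norm_nonneg _) one_pos
  set D := Real.sqrt 14 ^ p * ∑' j, sVal T j ^ p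
  refine ⟨σ ^ p * D, fun S hS θ => ?_⟩
  rw [← sum_blockIndex S fun s r => ‖dyadicPiece w γ (s + 3) (rot (2 ^ s) θ r)‖ ^ p]
  set h : ℤ → BlockIndex S → ℂ := fun q i => (2 ^ (i.1 : ℕ) : ℂ)⁻¹ * ∑ j ∈ rowBlock i.1,
    ∑ k ∈ colBlock i.1, γ (j + k) *
      (rot (2 ^ (i.1 : ℕ)) θ i.2 * ept (q * (2 * Real.pi) / 2 ^ ((i.1 : ℕ) + 4))) ^ (j + k) with hh
  have hsum : ∀ i, HasSum (fun q => c q * h q i)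
      (dyadicPiece w γ (i.1 + 3) (rot (2 ^ (i.1 : ℕ)) θ i.2)) := fun i =>
    hasSum_dyadicPiece hw hc γ i.1 _
  have hD : ∀ q, ∑ i, ‖h q i‖ ^ p ≤ D := fun q => by
    have := sum_norm_block_average_rpow_le hp T hT hx hy hγ hS
      fun s => θ + q * (2 * Real.pi) / 2 ^ (s + 4)
    simpa only [hh, rot_mul_ept] using this
  have hD0 : 0 ≤ D := le_trans (Finset.sum_nonneg fun _ _ => by positivity) (hD 0)
  have hfin : ∀ Q : Finset ℤ, ∑ i, ‖∑ q ∈ Q, c q * h q i‖ ^ p ≤ σ ^ p * D := by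
    intro Q
    have hQ : ∑ q ∈ Q, ‖c q‖ / σ ≤ 1 := by
      rw [← Finset.sum_div, div_le_one hσ0]
      linarith [hc1.sum_le_tsum Q fun _ _ => norm_nonneg _]
    calc ∑ i, ‖∑ q ∈ Q, c q * h q i‖ ^ p
        ≤ ∑ i, σ ^ p * ∑ q ∈ Q, ‖c q‖ / σ * ‖h q i‖ ^ p := by
          refine Finset.sum_le_sum fun i _ => ?_
          have h1 : ‖∑ q ∈ Q, c q * h q i‖ ≤ σ * ∑ q ∈ Q, ‖c q‖ / σ * ‖h q i‖ := by
            refine (norm_sum_le _ _).trans (le_of_eq ?_)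
            rw [Finset.mul_sum]
            refine Finset.sum_congr rfl fun q _ => ?_
            rw [norm_mul]; field_simp
          refine (Real.rpow_le_rpow (norm_nonneg _) h1 (by linarith)).trans ?_
          rw [Real.mul_rpow hσ0.le (Finset.sum_nonneg fun q _ => by positivity)]
          gcongr
          exact rpow_weighted_sum_le Q hp _ _ (fun q => by positivity) (fun q => norm_nonneg _) hQ
      _ = σ ^ p * ∑ q ∈ Q, ‖c q‖ / σ * ∑ i, ‖h q i‖ ^ p := by
          rw [← Finset.mul_sum, Finset.sum_comm]
          simp_rw [Finset.mul_sum]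
      _ ≤ σ ^ p * ∑ q ∈ Q, ‖c q‖ / σ * D := by
          gcongr with q _
          exact hD q
      _ ≤ σ ^ p * D := by
          rw [← Finset.sum_mul]
          gcongr
          exact mul_le_of_le_one_left hD0 hQ
  refine le_of_tendsto' (x := Filter.atTop)
    (f := fun Q : Finset ℤ => ∑ i, ‖∑ q ∈ Q, c q * h q i‖ ^ p) ?_ hfin
  refine tendsto_finsetSum _ fun i _ => ?_
  exact (Filter.Tendsto.norm (hsum i)).rpow_const (Or.inr (by linarith))

end LargeExponent

section Atomic

/-- A kernel is a finite sum of rank one kernels `x ⊗ z̄` whose vectors have `2 * p`-th powers of norms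
summing to at most `c`. -/
def AtomicLe {ι κ : Type} [Fintype ι] [Fintype κ] (p : ℝ) (A : ι → κ → ℂ) (c : ℝ) : Prop :=
  ∃ (α : Type) (_ : Fintype α) (x : α → EuclideanSpace ℂ ι) (z : α → EuclideanSpace ℂ κ),
    (∀ j k, A j k = ∑ a, x a j * (starRingEnd ℂ) (z a k)) ∧
    ∑ a, ‖x a‖ ^ (2 * p) ≤ c ∧ ∑ a, ‖z a‖ ^ (2 * p) ≤ c

namespace AtomicLe

variable {ι κ : Type} [Fintype ι] [Fintype κ] {p : ℝ}

lemma mono {A : ι → κ → ℂ} {c c' : ℝ} (h : AtomicLe p A c) (hc : c ≤ c') : AtomicLe p A c' := by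
  obtain ⟨α, _, x, z, h1, h2, h3⟩ := h
  exact ⟨α, _, x, z, h1, h2.trans hc, h3.trans hc⟩

lemma congr {A A' : ι → κ → ℂ} {c : ℝ} (h : AtomicLe p A c) (hA : ∀ j k, A' j k = A j k) :
    AtomicLe p A' c := by
  rwa [show A' = A from funext fun j => funext (hA j)]

lemma zero : AtomicLe p (fun (_ : ι) (_ : κ) => (0 : ℂ)) 0 :=
  ⟨Empty, inferInstance, Empty.elim, Empty.elim, by simp, by simp, by simp⟩

lemma add {A A' : ι → κ → ℂ} {c c' : ℝ} (h : AtomicLe p A c) (h' : AtomicLe p A' c') :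
    AtomicLe p (fun j k => A j k + A' j k) (c + c') := by
  obtain ⟨α, _, x, z, h1, h2, h3⟩ := h
  obtain ⟨β, _, x', z', h1', h2', h3'⟩ := h'
  refine ⟨α ⊕ β, inferInstance, Sum.elim x x', Sum.elim z z', fun j k => ?_, ?_, ?_⟩
  · simp [h1, h1']
  · simpa using add_le_add h2 h2'
  · simpa using add_le_add h3 h3'

lemma sum {ν : Type} (s : Finset ν) (A : ν → ι → κ → ℂ) (c : ν → ℝ)
    (h : ∀ a ∈ s, AtomicLe p (A a) (c a)) :
    AtomicLe p (fun j k => ∑ a ∈ s, A a j k) (∑ a ∈ s, c a) := by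
  classical
  induction s using Finset.induction_on with
  | empty => simpa using zero
  | insert a s ha ih =>
    simp_rw [Finset.sum_insert ha]
    exact (h a (Finset.mem_insert_self a s)).add
      (ih fun b hb => h b (Finset.mem_insert_of_mem hb))

lemma schur {A : ι → κ → ℂ} {c : ℝ} (hp : 0 < p) (h : AtomicLe p A c) (a : ι → ℂ) (b : κ → ℂ)
    (ha : ∀ j, ‖a j‖ ≤ 1) (hb : ∀ k, ‖b k‖ ≤ 1) :
    AtomicLe p (fun j k => a j * b k * A j k) c := by
  have hnorm : ∀ {τ : Type} [Fintype τ] (u : τ → ℂ) (v : EuclideanSpace ℂ τ),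
      (∀ j, ‖u j‖ ≤ 1) → ‖WithLp.toLp 2 fun j => u j * v j‖ ^ (2 * p) ≤ ‖v‖ ^ (2 * p) := by
    intro τ _ u v hu
    refine Real.rpow_le_rpow (norm_nonneg _) ?_ (by linarith)
    rw [EuclideanSpace.norm_eq, EuclideanSpace.norm_eq]
    refine Real.sqrt_le_sqrt (Finset.sum_le_sum fun j _ => ?_)
    dsimp only
    rw [norm_mul]
    gcongr
    exact mul_le_of_le_one_left (norm_nonneg _) (hu j)
  obtain ⟨α, _, x, z, h1, h2, h3⟩ := h
  refine ⟨α, inferInstance, fun i => WithLp.toLp 2 fun j => a j * x i j,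
    fun i => WithLp.toLp 2 fun k => (starRingEnd ℂ) (b k) * z i k, fun j k => ?_, ?_, ?_⟩
  · dsimp only
    rw [h1, Finset.mul_sum]
    refine Finset.sum_congr rfl fun i _ => ?_
    simp only [map_mul, Complex.conj_conj]
    ring
  · exact (Finset.sum_le_sum fun i _ => hnorm a (x i) ha).trans h2
  · exact (Finset.sum_le_sum fun i _ => hnorm (fun k => (starRingEnd ℂ) (b k)) (z i)
      fun k => by rw [RCLike.norm_conj]; exact hb k).trans h3

lemma smul {A : ι → κ → ℂ} {c : ℝ} (hp : 0 < p) (h : AtomicLe p A c) (l : ℂ) :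
    AtomicLe p (fun j k => l * A j k) (‖l‖ ^ p * c) := by
  have h1 : AtomicLe p (fun j k => (‖l‖ : ℂ) * A j k) (‖l‖ ^ p * c) := by
    obtain ⟨α, _, x, z, h1, h2, h3⟩ := h
    have hs : ‖((Real.sqrt ‖l‖ : ℝ) : ℂ)‖ ^ (2 * p) = ‖l‖ ^ p := by
      rw [Complex.norm_real, Real.norm_of_nonneg (Real.sqrt_nonneg _), Real.rpow_mul
        (Real.sqrt_nonneg _), Real.rpow_two, Real.sq_sqrt (norm_nonneg _)]
    have hsq : ((Real.sqrt ‖l‖ : ℝ) : ℂ) * (Real.sqrt ‖l‖ : ℝ) = (‖l‖ : ℂ) := by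
      rw [← Complex.ofReal_mul, Real.mul_self_sqrt (norm_nonneg _)]
    refine ⟨α, inferInstance, fun i => ((Real.sqrt ‖l‖ : ℝ) : ℂ) • x i,
      fun i => ((Real.sqrt ‖l‖ : ℝ) : ℂ) • z i, fun j k => ?_, ?_, ?_⟩
    · dsimp only
      rw [h1, Finset.mul_sum, ← hsq]
      refine Finset.sum_congr rfl fun i _ => ?_
      simp only [PiLp.smul_apply, smul_eq_mul, map_mul, Complex.conj_ofReal]
      ring
    · simp_rw [norm_smul, Real.mul_rpow (norm_nonneg _) (norm_nonneg _), hs, ← Finset.mul_sum]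
      gcongr
    · simp_rw [norm_smul, Real.mul_rpow (norm_nonneg _) (norm_nonneg _), hs, ← Finset.mul_sum]
      gcongr
  refine (h1.schur hp (fun _ => l / ‖l‖) (fun _ => 1) (fun _ => ?_) (by simp)).congr fun j k => ?_
  · rw [norm_div, Complex.norm_real, norm_norm]
    exact div_self_le_one _
  · by_cases hl : l = 0
    · simp [hl]
    · have : (‖l‖ : ℂ) ≠ 0 := by simpa using hl
      field_simp

lemma rankOne (hp : 0 < p) (l : ℂ) (x : EuclideanSpace ℂ ι) (z : EuclideanSpace ℂ κ)
    (hx : ‖x‖ ≤ 1) (hz : ‖z‖ ≤ 1) :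
    AtomicLe p (fun j k => l * (x j * (starRingEnd ℂ) (z k))) (‖l‖ ^ p) := by
  have h : AtomicLe p (fun j k => x j * (starRingEnd ℂ) (z k)) 1 :=
    ⟨Unit, inferInstance, fun _ => x, fun _ => z, by simp,
      by simpa using Real.rpow_le_one (norm_nonneg _) hx (by linarith),
      by simpa using Real.rpow_le_one (norm_nonneg _) hz (by linarith)⟩
  simpa using h.smul hp l

lemma of_entries [DecidableEq ι] [DecidableEq κ] (hp : 0 < p) (A : ι → κ → ℂ) :
    AtomicLe p A (∑ j, ∑ k, ‖A j k‖ ^ p) := by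
  refine (sum Finset.univ (fun j' j k => ∑ k', A j' k' * ((EuclideanSpace.single j' (1 : ℂ)) j *
    (starRingEnd ℂ) ((EuclideanSpace.single k' (1 : ℂ)) k))) _ fun j' _ =>
    sum Finset.univ (fun k' j k => A j' k' * ((EuclideanSpace.single j' (1 : ℂ)) j *
    (starRingEnd ℂ) ((EuclideanSpace.single k' (1 : ℂ)) k))) _ fun k' _ =>
      rankOne hp (A j' k') _ _ (by simp) (by simp)).congr fun j k => ?_
  simp [Finset.sum_ite_eq, apply_ite]

/-- The kernel of a Schatten class operator with respect to orthonormal families. -/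
lemma of_memSchatten {H : Type} [NormedAddCommGroup H] [InnerProductSpace ℂ H] [CompleteSpace H]
    (hp : 0 < p) (T : H →L[ℂ] H) (hT : MemSchatten p T) (u : ι → H) (v : κ → H)
    (hu : Orthonormal ℂ u) (hv : Orthonormal ℂ v) :
    AtomicLe p (fun j k => inner ℂ (u j) (T (v k))) (∑' j, sVal T j ^ p) := by
  classical
  set Y := synthesis v with hY
  obtain ⟨n, hn⟩ : ∃ n, Module.finrank ℂ (EuclideanSpace ℂ κ) = n := ⟨_, rfl⟩
  obtain ⟨b, hb, hanti⟩ := exists_orthonormalBasis_orthogonal_image hn (T ∘L Y)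
  refine AtomicLe.mono ?_
    (sum_norm_image_rpow_le hp T hT Y (norm_synthesis_le hv) b hb hanti)
  set A := T ∘L Y with hA
  set x : Fin n → EuclideanSpace ℂ ι := fun i =>
    WithLp.toLp 2 fun j => inner ℂ (u j) (((‖A (b i)‖ : ℂ))⁻¹ • A (b i)) with hx
  have hx1 : ∀ i, ‖x i‖ ≤ 1 := by
    intro i
    refine le_of_sq_le_sq ?_ zero_le_one
    rw [EuclideanSpace.norm_sq_eq, one_pow]
    refine (sum_norm_inner_sq_le u (fun i j h => hu.2 h) (fun i => (hu.1 i).le) _).trans ?_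
    rw [norm_smul, norm_inv, Complex.norm_real, norm_norm]
    exact pow_le_one₀ (by positivity) (inv_mul_le_one)
  have hsum := AtomicLe.sum Finset.univ
    (fun i j k => ((‖A (b i)‖ : ℝ) : ℂ) * (x i j * (starRingEnd ℂ) (b i k))) _ fun i _ =>
    AtomicLe.rankOne hp ((‖A (b i)‖ : ℝ) : ℂ) (x i) (b i) (hx1 i) (b.norm_eq_one i).le
  refine (hsum.congr fun j k => ?_).mono (le_of_eq ?_)
  · have hk : T (v k) = A (EuclideanSpace.single k 1) := by
      rw [hA, ContinuousLinearMap.comp_apply, hY, synthesis_single]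
    rw [hk, ← b.sum_repr' (EuclideanSpace.single k (1 : ℂ)), map_sum, inner_sum]
    refine Finset.sum_congr rfl fun i _ => ?_
    rw [map_smul, inner_smul_right, EuclideanSpace.inner_single_right, hx]
    simp only [inner_smul_right, one_mul]
    by_cases h0 : A (b i) = 0
    · simp [h0]
    · have : (‖A (b i)‖ : ℂ) ≠ 0 := by simpa using h0
      field_simp
  · simp

/-- If an atomic kernel maps orthonormal vectors to orthogonal ones, the norms of the images are
controlled. -/
lemma sum_norm_image_le [DecidableEq κ] {A : ι → κ → ℂ} {c : ℝ} (hp : 0 < p) (hp1 : p ≤ 1)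
    (h : AtomicLe p A c) {I : Type} [Fintype I] (u : I → EuclideanSpace ℂ κ)
    (hu : Orthonormal ℂ u) (g : I → EuclideanSpace ℂ ι) (hg : ∀ i j, g i j = ∑ k, A j k * u i k)
    (horth : ∀ i i', i ≠ i' → inner ℂ (g i) (g i') = 0) :
    ∑ i, ‖g i‖ ^ p ≤ 2 * c := by
  classical
  obtain ⟨α, _, x, z, h1, h2, h3⟩ := h
  have e : ∀ i, (synthesis x ∘L ContinuousLinearMap.adjoint (synthesis z)) (u i) = g i := by
    intro i
    have e1 : ∀ a, ContinuousLinearMap.adjoint (synthesis z) (u i) a = inner ℂ (z a) (u i) := by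
      intro a
      have := ContinuousLinearMap.adjoint_inner_right (synthesis z) (EuclideanSpace.single a 1) (u i)
      rw [synthesis_single, EuclideanSpace.inner_single_left] at this
      simpa using this
    ext j
    rw [ContinuousLinearMap.comp_apply, synthesis_apply, hg]
    simp only [e1, h1]
    simp only [WithLp.ofLp_sum, WithLp.ofLp_smul, Finset.sum_apply, Pi.smul_apply, smul_eq_mul,
      PiLp.inner_apply, RCLike.inner_apply, Finset.sum_mul]
    rw [Finset.sum_comm]
    refine Finset.sum_congr rfl fun k _ => Finset.sum_congr rfl fun a _ => ?_
    ring
  have := sum_norm_image_factorization_le hp hp1 (synthesis x) (synthesis z) u hu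
    (fun i i' h => by rw [e, e]; exact horth i i' h)
  simp only [e, synthesis_single] at this
  linarith

end AtomicLe

end Atomic

section Indicators

/-- The indicator of a finite set of indices, with complex values. -/
def ind (B : Finset ℕ) (k : ℕ) : ℂ := if k ∈ B then 1 else 0

lemma ind_of_mem {B : Finset ℕ} {k : ℕ} (h : k ∈ B) : ind B k = 1 := if_pos h

lemma ind_of_notMem {B : Finset ℕ} {k : ℕ} (h : k ∉ B) : ind B k = 0 := if_neg h

lemma ind_mul_sum_ind {S : Finset ℕ} {B : ℕ → Finset ℕ}
    (hB : ∀ s ∈ S, ∀ t ∈ S, s ≠ t → Disjoint (B s) (B t)) (a : ℕ → ℂ) (k : ℕ) {s : ℕ}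
    (hs : s ∈ S) : ind (B s) k * ∑ t ∈ S, ind (B t) k * a t = ind (B s) k * a s := by
  by_cases h : k ∈ B s
  · rw [Finset.sum_eq_single_of_mem s hs, ind_of_mem h, one_mul]
    intro t ht hts
    rw [ind_of_notMem (Finset.disjoint_left.1 (hB s hs t ht hts.symm) h), zero_mul]
  · rw [ind_of_notMem h, zero_mul, zero_mul]

lemma norm_sum_ind_le_one {S : Finset ℕ} {B : ℕ → Finset ℕ}
    (hB : ∀ s ∈ S, ∀ t ∈ S, s ≠ t → Disjoint (B s) (B t)) (a : ℕ → ℂ) (ha : ∀ s, ‖a s‖ ≤ 1)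
    (k : ℕ) : ‖∑ t ∈ S, ind (B t) k * a t‖ ≤ 1 := by
  by_cases h : ∃ s ∈ S, k ∈ B s
  · obtain ⟨s, hs, hk⟩ := h
    have := ind_mul_sum_ind hB a k hs
    rw [ind_of_mem hk, one_mul, one_mul] at this
    rw [this]
    exact ha s
  · push Not at h
    rw [Finset.sum_eq_zero]
    · simp
    · intro s hs
      rw [ind_of_notMem (h s hs), zero_mul]

lemma sum_fin_ind_mul {d : ℕ} {B : Finset ℕ} (hB : B ⊆ Finset.range d) (g : ℕ → ℂ) :
    ∑ k : Fin d, ind B k * g k = ∑ k ∈ B, g k := by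
  rw [Fin.sum_univ_eq_sum_range (fun k => ind B k * g k) d, ← Finset.sum_subset hB]
  · exact Finset.sum_congr rfl fun k hk => by rw [ind_of_mem hk, one_mul]
  · intro k _ hk
    rw [ind_of_notMem hk, zero_mul]

/-- The elements of `Fin d` with value in `B`. -/
def finBlock (d : ℕ) (B : Finset ℕ) : Finset (Fin d) := Finset.univ.filter fun k => (k : ℕ) ∈ B

lemma sum_finBlock {d : ℕ} {B : Finset ℕ} (hB : B ⊆ Finset.range d) (g : ℕ → ℂ) :
    ∑ k ∈ finBlock d B, g k = ∑ k ∈ B, g k := by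
  rw [← sum_fin_ind_mul hB, finBlock, Finset.sum_filter]
  exact Finset.sum_congr rfl fun k _ => by unfold ind; split_ifs <;> simp

lemma card_finBlock {d : ℕ} {B : Finset ℕ} (hB : B ⊆ Finset.range d) :
    (finBlock d B).card = B.card := by
  have := sum_finBlock hB fun _ => (1 : ℂ)
  simpa using this

lemma sum_finBlock_single_apply {d : ℕ} (B : Finset ℕ) (β : Fin d → ℂ) (j : Fin d) :
    (∑ k ∈ finBlock d B, β k • EuclideanSpace.single k (1 : ℂ)) j = ind B j * β j := by
  simp only [WithLp.ofLp_sum, WithLp.ofLp_smul, Finset.sum_apply, Pi.smul_apply, smul_eq_mul]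
  rw [finBlock, Finset.sum_filter, Finset.sum_eq_single j]
  · unfold ind; split_ifs <;> simp
  · intro k _ hk
    simp [Ne.symm hk]
  · simp

lemma norm_toLp_ind_le_one {d : ℕ} {B : Finset ℕ} (β : ℕ → ℂ) (hβ : ∀ k, ‖β k‖ = 1) :
    ‖(WithLp.toLp 2 fun k : Fin d => (((Real.sqrt B.card)⁻¹ : ℝ) : ℂ) * (ind B k * β k) :
      EuclideanSpace ℂ (Fin d))‖ ≤ 1 := by
  refine le_of_sq_le_sq ?_ zero_le_one
  rw [EuclideanSpace.norm_sq_eq, one_pow]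
  have h1 : ∀ k : ℕ, ‖(((Real.sqrt B.card)⁻¹ : ℝ) : ℂ) * (ind B k * β k)‖ ^ 2 =
      if k ∈ B then (B.card : ℝ)⁻¹ else 0 := by
    intro k
    rw [norm_mul, norm_mul, hβ, Complex.norm_real, norm_inv, Real.norm_of_nonneg
      (Real.sqrt_nonneg _), mul_pow, inv_pow, Real.sq_sqrt (Nat.cast_nonneg _)]
    unfold ind; split_ifs <;> simp
  calc ∑ k : Fin d, ‖(((Real.sqrt B.card)⁻¹ : ℝ) : ℂ) * (ind B k * β k)‖ ^ 2
      = ∑ k ∈ Finset.range d, if k ∈ B then (B.card : ℝ)⁻¹ else 0 := by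
        simp_rw [h1]
        exact Fin.sum_univ_eq_sum_range (fun k => if k ∈ B then (B.card : ℝ)⁻¹ else 0) d
    _ ≤ ∑ k ∈ B, (B.card : ℝ)⁻¹ := by
        rw [← Finset.sum_filter]
        exact Finset.sum_le_sum_of_subset_of_nonneg (fun k hk => (Finset.mem_filter.1 hk).2)
          fun _ _ _ => by positivity
    _ ≤ 1 := by
        rw [Finset.sum_const, nsmul_eq_mul]
        exact mul_inv_le_one

lemma norm_sum_rpow_le {ν : Type} (s : Finset ν) (g : ν → ℂ) {p : ℝ} (hp : 0 < p) (hp1 : p ≤ 1) :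
    ‖∑ a ∈ s, g a‖ ^ p ≤ ∑ a ∈ s, ‖g a‖ ^ p := by
  classical
  induction s using Finset.induction_on with
  | empty => simp [Real.zero_rpow hp.ne']
  | insert a s ha ih =>
    rw [Finset.sum_insert ha, Finset.sum_insert ha]
    refine (Real.rpow_le_rpow (norm_nonneg _) (norm_add_le _ _) hp.le).trans ?_
    refine (Real.rpow_add_le_add_rpow (norm_nonneg _) (norm_nonneg _) hp.le hp1).trans ?_
    gcongr

end Indicators

section OffDiagonal

/-- Samples of the dyadic pieces around the scale `2^u`. -/
def sampleSum (w : ℝ → ℝ) (γ : ℕ → ℂ) (p : ℝ) (u : ℕ) (θ : ℝ) : ℝ :=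
  ∑ m ∈ Finset.Ico u (u + 6), ∑ r ∈ Finset.range (2 ^ (u + 6)),
    ‖dyadicPiece w γ m (rot (2 ^ (u + 6)) θ r)‖ ^ p

lemma sampleSum_nonneg (w : ℝ → ℝ) (γ : ℕ → ℂ) (p : ℝ) (u : ℕ) (θ : ℝ) :
    0 ≤ sampleSum w γ p u θ :=
  Finset.sum_nonneg fun _ _ => Finset.sum_nonneg fun _ _ => by positivity

/-- Rectangles of a Hankel kernel with sides of different sizes are small. -/
lemma atomicLe_offDiagonal {w : ℝ → ℝ} (hw : AdmissibleWeight w) {p : ℝ} (hp : 0 < p)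
    (hp1 : p ≤ 1) (γ : ℕ → ℂ) (d s t : ℕ) (θ : ℝ) :
    AtomicLe p (fun j k : Fin d => ind (rowBlock s) j * ind (colBlock t) k * γ (j + k))
      (((Real.sqrt 2)⁻¹ ^ p) ^ (max s t - min s t) * sampleSum w γ p (max s t) θ) := by
  set u := max s t with hu
  set n := u - min s t with hn
  have hst : s + t + n = 2 * u := by omega
  set G : ℕ → ℂ := fun r => ∑ m ∈ Finset.Ico u (u + 6), dyadicPiece w γ m (rot (2 ^ (u + 6)) θ r)
    with hG
  set η : ℕ → ℂ := fun r => rot (2 ^ (u + 6)) θ r with hη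
  set a : ℝ := Real.sqrt (rowBlock s).card with ha
  set b : ℝ := Real.sqrt (colBlock t).card with hb
  have ha0 : 0 < a := Real.sqrt_pos.2 (by rw [card_rowBlock]; positivity)
  have hb0 : 0 < b := Real.sqrt_pos.2 (by rw [card_colBlock]; positivity)
  set l : ℕ → ℂ := fun r => (((2 ^ (u + 6))⁻¹ * (a * b) : ℝ) : ℂ) * G r with hl
  have hsmall : (2 ^ (u + 6))⁻¹ * (a * b) ≤ (Real.sqrt 2)⁻¹ ^ n := by
    refine le_of_sq_le_sq ?_ (by positivity)
    rw [mul_pow, mul_pow, Real.sq_sqrt (Nat.cast_nonneg _), Real.sq_sqrt (Nat.cast_nonneg _),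
      card_rowBlock, card_colBlock, ← pow_mul, mul_comm n 2, pow_mul, inv_pow (Real.sqrt 2),
      Real.sq_sqrt (by norm_num), inv_pow, inv_pow, ← pow_mul, inv_mul_le_iff₀ (by positivity)]
    push_cast
    rw [← div_eq_mul_inv, le_div_iff₀ (by positivity)]
    calc (2 : ℝ) ^ s * (14 * 2 ^ t) * 2 ^ n = 14 * 2 ^ (s + t + n) := by ring
      _ = 14 * 2 ^ (2 * u) := by rw [hst]
      _ ≤ 2 ^ 12 * 2 ^ (2 * u) := by gcongr; norm_num
      _ = 2 ^ ((u + 6) * 2) := by ring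
  have hsum := AtomicLe.sum (Finset.range (2 ^ (u + 6))) _ _ fun r _ =>
    AtomicLe.rankOne (p := p) hp (l r)
      (WithLp.toLp 2 fun j : Fin d => ((a⁻¹ : ℝ) : ℂ) *
        (ind (rowBlock s) j * (starRingEnd ℂ) (η r ^ (j : ℕ))))
      (WithLp.toLp 2 fun k : Fin d => ((b⁻¹ : ℝ) : ℂ) * (ind (colBlock t) k * η r ^ (k : ℕ)))
      (norm_toLp_ind_le_one (fun j => (starRingEnd ℂ) (η r ^ j))
        fun k => by rw [RCLike.norm_conj, norm_pow, norm_rot, one_pow])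
      (norm_toLp_ind_le_one (fun j => η r ^ j) fun k => by rw [norm_pow, norm_rot, one_pow])
  refine (hsum.congr fun j k => ?_).mono ?_
  · by_cases hj : (j : ℕ) ∈ rowBlock s
    swap
    · simp [ind_of_notMem hj]
    by_cases hk : (k : ℕ) ∈ colBlock t
    swap
    · simp [ind_of_notMem hk]
    simp only [ind_of_mem hj, ind_of_mem hk, one_mul]
    simp only [rowBlock, colBlock, Finset.mem_Ico] at hj hk
    have h1 : 2 ^ u ≤ (j : ℕ) + k := by
      rcases le_total s t with h | h
      · rw [hu, max_eq_right h]
        have : 2 ^ t ≤ 2 ^ (t + 1) := Nat.pow_le_pow_right two_pos (by omega)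
        omega
      · rw [hu, max_eq_left h]; omega
    have h2 : (j : ℕ) + k < 2 ^ (u + 5) := by
      have e1 : 2 ^ (s + 1) ≤ 2 ^ (u + 1) := Nat.pow_le_pow_right two_pos (by omega)
      have e2 : 2 ^ (t + 4) ≤ 2 ^ (u + 4) := Nat.pow_le_pow_right two_pos (by omega)
      have e3 : 2 ^ (u + 1) ≤ 2 ^ (u + 4) := Nat.pow_le_pow_right two_pos (by omega)
      rw [pow_succ 2 (u + 4)]
      omega
    have key := sum_rot_dyadicPiece hw γ θ h1 h2
    have e : ∀ r, l r * (((a⁻¹ : ℝ) : ℂ) * (starRingEnd ℂ) (η r ^ (j : ℕ)) *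
        (starRingEnd ℂ) (((b⁻¹ : ℝ) : ℂ) * η r ^ (k : ℕ))) =
        (2 ^ (u + 6) : ℂ)⁻¹ * (G r * (starRingEnd ℂ) (η r ^ ((j : ℕ) + k))) := by
      intro r
      rw [pow_add (η r), map_mul, map_mul, Complex.conj_ofReal]
      simp only [hl]
      push_cast
      have ha' : (a : ℂ) ≠ 0 := by exact_mod_cast ha0.ne'
      have hb' : (b : ℂ) ≠ 0 := by exact_mod_cast hb0.ne'
      field_simp
    simp_rw [e]
    rw [← Finset.mul_sum, hG, hη, key, inv_mul_cancel_left₀ (pow_ne_zero _ two_ne_zero)]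
  · calc ∑ r ∈ Finset.range (2 ^ (u + 6)), ‖l r‖ ^ p
        ≤ ∑ r ∈ Finset.range (2 ^ (u + 6)), ((Real.sqrt 2)⁻¹ ^ p) ^ n *
          ∑ m ∈ Finset.Ico u (u + 6), ‖dyadicPiece w γ m (η r)‖ ^ p := by
          refine Finset.sum_le_sum fun r _ => ?_
          have hρ : ((Real.sqrt 2)⁻¹ ^ p) ^ n = ((Real.sqrt 2)⁻¹ ^ n) ^ p := by
            rw [← Real.rpow_natCast, ← Real.rpow_mul (by positivity), mul_comm,
              Real.rpow_mul (by positivity), Real.rpow_natCast]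
          rw [hρ, hl, norm_mul, Complex.norm_real, Real.norm_of_nonneg (by positivity),
            Real.mul_rpow (by positivity) (norm_nonneg _)]
          gcongr
          exact norm_sum_rpow_le _ _ hp hp1
      _ = _ := by
          rw [← Finset.mul_sum, Finset.sum_comm, sampleSum]

end OffDiagonal

section SmallExponent

variable {H : Type} [NormedAddCommGroup H] [InnerProductSpace ℂ H] [CompleteSpace H]

/-- The contribution of the rectangles off the diagonal. -/
def offDiagonalSum (w : ℝ → ℝ) (γ : ℕ → ℂ) (p : ℝ) (S : Finset ℕ) (θ : ℝ) : ℝ :=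
  ∑ s ∈ S, ∑ t ∈ S.erase s,
    ((Real.sqrt 2)⁻¹ ^ p) ^ (max s t - min s t) * sampleSum w γ p (max s t) θ

lemma offDiagonalSum_nonneg (w : ℝ → ℝ) (γ : ℕ → ℂ) (p : ℝ) (S : Finset ℕ) (θ : ℝ) :
    0 ≤ offDiagonalSum w γ p S θ :=
  Finset.sum_nonneg fun _ _ => Finset.sum_nonneg fun _ _ =>
    mul_nonneg (by positivity) (sampleSum_nonneg _ _ _ _ _)

lemma one_le_of_ind_rowBlock {s j : ℕ} (h : j ∈ rowBlock s) : 1 ≤ j := by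
  simp only [rowBlock, Finset.mem_Ico] at h
  exact Nat.one_le_two_pow.trans h.1

lemma one_le_of_ind_colBlock {s j : ℕ} (h : j ∈ colBlock s) : 1 ≤ j := by
  simp only [colBlock, Finset.mem_Ico] at h
  exact Nat.one_le_two_pow.trans h.1

lemma atomicLe_diagonalBlocks {w : ℝ → ℝ} (hw : AdmissibleWeight w) {p : ℝ} (hp : 0 < p)
    (hp1 : p ≤ 1) (T : H →L[ℂ] H) (hT : MemSchatten p T) {x y : ℕ → H} (hx : Orthonormal ℂ x)
    (hy : Orthonormal ℂ y) {γ : ℕ → ℂ}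
    (hγ : ∀ j k, 1 ≤ j → 1 ≤ k → inner ℂ (x j) (T (y k)) = γ (j + k))
    {S : Finset ℕ} (hS : Separated S) (d : ℕ) (θ : ℝ) :
    AtomicLe p (fun j k : Fin d => ∑ s ∈ S, ind (rowBlock s) j * ind (colBlock s) k * γ (j + k))
      (∑' j, sVal T j ^ p + offDiagonalSum w γ p S θ) := by
  have h1 := (AtomicLe.of_memSchatten (ι := Fin d) (κ := Fin d) hp T hT (fun j => x j)
    (fun k => y k) (hx.comp _ Fin.val_injective) (hy.comp _ Fin.val_injective)).schur hp
    (fun j => ∑ s ∈ S, ind (rowBlock s) j * 1) (fun k => ∑ s ∈ S, ind (colBlock s) k * 1)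
    (fun j => norm_sum_ind_le_one (fun _ _ _ _ h => disjoint_rowBlock h) _ (by simp) j)
    (fun k => norm_sum_ind_le_one (fun _ hs _ ht h => hS.disjoint_colBlock hs ht h) _ (by simp) k)
  have h2 : AtomicLe p (fun j k : Fin d => ∑ s ∈ S, ∑ t ∈ S.erase s,
      (-1) * (ind (rowBlock s) j * ind (colBlock t) k * γ (j + k)))
      (offDiagonalSum w γ p S θ) :=
    AtomicLe.sum S _ _ fun s _ => AtomicLe.sum (S.erase s) _ _ fun t _ => by
      simpa using (atomicLe_offDiagonal hw hp hp1 γ d s t θ).smul hp (-1)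
  refine (h1.add h2).congr fun j k => ?_
  have e1 : (∑ s ∈ S, ind (rowBlock s) j * 1) * (∑ s ∈ S, ind (colBlock s) k * 1) *
      inner ℂ (x j) (T (y k)) =
      ∑ s ∈ S, ∑ t ∈ S, ind (rowBlock s) j * ind (colBlock t) k * γ (j + k) := by
    rw [Finset.sum_mul_sum, Finset.sum_mul]
    refine Finset.sum_congr rfl fun s _ => ?_
    rw [Finset.sum_mul]
    refine Finset.sum_congr rfl fun t _ => ?_
    by_cases hj : (j : ℕ) ∈ rowBlock s
    · by_cases hk : (k : ℕ) ∈ colBlock t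
      · rw [hγ j k (one_le_of_ind_rowBlock hj) (one_le_of_ind_colBlock hk), mul_one, mul_one]
      · simp [ind_of_notMem hk]
    · simp [ind_of_notMem hj]
  rw [e1, ← Finset.sum_add_distrib]
  refine Finset.sum_congr rfl fun s hs => ?_
  rw [← Finset.add_sum_erase S _ hs, ← Finset.mul_sum]
  ring

lemma atomicLe_modulatedBlocks {w : ℝ → ℝ} (hw : AdmissibleWeight w) {p : ℝ} (hp : 0 < p)
    (hp1 : p ≤ 1) (T : H →L[ℂ] H) (hT : MemSchatten p T) {x y : ℕ → H} (hx : Orthonormal ℂ x)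
    (hy : Orthonormal ℂ y) {γ : ℕ → ℂ}
    (hγ : ∀ j k, 1 ≤ j → 1 ≤ k → inner ℂ (x j) (T (y k)) = γ (j + k))
    {S : Finset ℕ} (hS : Separated S) (d : ℕ) (θ : ℝ) (c : ℤ → ℂ) (z : ℤ → ℕ → ℂ)
    (hz : ∀ q s, ‖z q s‖ = 1) (Q : Finset ℤ) :
    AtomicLe p (fun j k : Fin d => ∑ s ∈ S, ind (rowBlock s) j * ind (colBlock s) k *
        ((∑ q ∈ Q, c q * z q s ^ ((j : ℕ) + k)) * γ (j + k)))
      ((∑ q ∈ Q, ‖c q‖ ^ p) * (∑' j, sVal T j ^ p + offDiagonalSum w γ p S θ)) := by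
  have hB := atomicLe_diagonalBlocks hw hp hp1 T hT hx hy hγ hS d θ
  have hr : ∀ s ∈ S, ∀ t ∈ S, s ≠ t → Disjoint (rowBlock s) (rowBlock t) :=
    fun _ _ _ _ h => disjoint_rowBlock h
  have hc : ∀ s ∈ S, ∀ t ∈ S, s ≠ t → Disjoint (colBlock s) (colBlock t) :=
    fun _ hs _ ht h => hS.disjoint_colBlock hs ht h
  rw [Finset.sum_mul]
  refine (AtomicLe.sum Q _ _ fun q _ => (hB.schur hp
    (fun j => ∑ s ∈ S, ind (rowBlock s) j * z q s ^ (j : ℕ))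
    (fun k => ∑ s ∈ S, ind (colBlock s) k * z q s ^ (k : ℕ))
    (fun j => norm_sum_ind_le_one hr _ (fun s => by rw [norm_pow, hz, one_pow]) j)
    (fun k => norm_sum_ind_le_one hc _ (fun s => by rw [norm_pow, hz, one_pow]) k)).smul hp
      (c q)).congr fun j k => ?_
  have e : ∀ q ∈ Q, c q * ((∑ s ∈ S, ind (rowBlock s) j * z q s ^ (j : ℕ)) *
      (∑ s ∈ S, ind (colBlock s) k * z q s ^ (k : ℕ)) *
      ∑ s ∈ S, ind (rowBlock s) j * ind (colBlock s) k * γ (j + k)) =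
      ∑ s ∈ S, ind (rowBlock s) j * ind (colBlock s) k *
        (c q * z q s ^ ((j : ℕ) + k) * γ (j + k)) := by
    intro q _
    rw [Finset.mul_sum, Finset.mul_sum]
    refine Finset.sum_congr rfl fun s hs => ?_
    have f1 := ind_mul_sum_ind hr (fun s => z q s ^ (j : ℕ)) j hs
    have f2 := ind_mul_sum_ind hc (fun s => z q s ^ (k : ℕ)) k hs
    calc _ = c q * γ (j + k) * (ind (rowBlock s) j * ∑ s ∈ S, ind (rowBlock s) j * z q s ^ (j : ℕ))
          * (ind (colBlock s) k * ∑ s ∈ S, ind (colBlock s) k * z q s ^ (k : ℕ)) := by ring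
      _ = _ := by rw [f1, f2, pow_add]; ring
  rw [Finset.sum_congr rfl e, Finset.sum_comm]
  refine Finset.sum_congr rfl fun s _ => ?_
  rw [← Finset.mul_sum, ← Finset.sum_mul]

lemma subset_range_of_mem {S : Finset ℕ} {s : ℕ} (hs : s ∈ S) :
    rowBlock s ⊆ Finset.range (2 ^ (S.sup id + 4)) ∧
      colBlock s ⊆ Finset.range (2 ^ (S.sup id + 4)) := by
  have h : s ≤ S.sup id := Finset.le_sup (f := id) hs
  have h1 : 2 ^ (s + 4) ≤ 2 ^ (S.sup id + 4) := Nat.pow_le_pow_right two_pos (by omega)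
  have h2 : 2 ^ (s + 1) ≤ 2 ^ (s + 4) := Nat.pow_le_pow_right two_pos (by omega)
  constructor <;> intro k hk <;> simp only [rowBlock, colBlock, Finset.mem_Ico] at hk <;>
    rw [Finset.mem_range] <;> omega

lemma sum_inter_finBlock {d : ℕ} {B B' : Finset ℕ} (hB : B ⊆ Finset.range d) (g : ℕ → ℂ) :
    ∑ k ∈ finBlock d B ∩ finBlock d B', g k = ∑ k ∈ B ∩ B', g k := by
  rw [← sum_finBlock (Finset.inter_subset_left.trans hB)]
  congr 1
  ext k
  simp [finBlock]

/-- Vectors spread over disjoint blocks with frequencies given by roots of unity. -/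
lemma orthonormal_finBlock {S : Finset ℕ} {B : ℕ → Finset ℕ} {d : ℕ}
    (hBd : ∀ s ∈ S, B s ⊆ Finset.range d) (hne : ∀ s, (B s).Nonempty)
    (hB : ∀ s ∈ S, ∀ t ∈ S, s ≠ t → Disjoint (B s) (B t)) (β : BlockIndex S → ℕ → ℂ)
    (hβ : ∀ i k, ‖β i k‖ = 1)
    (h : ∀ i i' : BlockIndex S, i.1 = i'.1 → i ≠ i' →
      ∑ k ∈ B i.1, (starRingEnd ℂ) (β i k) * β i' k = 0) :
    Orthonormal ℂ fun i : BlockIndex S => (((Real.sqrt (B i.1).card)⁻¹ : ℝ) : ℂ) •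
      ∑ k ∈ finBlock d (B i.1), β i k • EuclideanSpace.single k (1 : ℂ) := by
  have := orthonormal_unimodular_sum (EuclideanSpace.orthonormal_single (𝕜 := ℂ) (ι := Fin d))
    (fun i : BlockIndex S => finBlock d (B i.1))
    (fun i => Finset.card_pos.1 (by
      rw [card_finBlock (hBd _ i.1.2)]
      exact (hne _).card_pos))
    (fun i k => β i k) (fun i k => hβ i k) fun i i' hi => ?_
  · simpa only [card_finBlock (hBd _ (Subtype.coe_prop _))] using this
  · rw [sum_inter_finBlock (hBd _ i.1.2) fun k => (starRingEnd ℂ) (β i k) * β i' k]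
    by_cases h1 : i.1 = i'.1
    · rw [← h1, Finset.inter_self, h i i' h1 hi]
    · rw [Finset.disjoint_iff_inter_eq_empty.1 (hB _ i.1.2 _ i'.1.2 fun h2 => h1 (Subtype.ext h2)),
        Finset.sum_empty]

/-- For `p ≤ 1`, the samples of the dyadic pieces of a Hankel symbol are controlled by the singular
values, up to the contribution of the rectangles off the diagonal. -/
lemma sum_samples_le_of_le_one {w : ℝ → ℝ} (hw : AdmissibleWeight w) {p : ℝ} (hp : 0 < p)
    (hp1 : p ≤ 1) (T : H →L[ℂ] H) (hT : MemSchatten p T) {x y : ℕ → H} (hx : Orthonormal ℂ x)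
    (hy : Orthonormal ℂ y) {γ : ℕ → ℂ}
    (hγ : ∀ j k, 1 ≤ j → 1 ≤ k → inner ℂ (x j) (T (y k)) = γ (j + k)) :
    ∃ C C' : ℝ, 0 ≤ C' ∧ ∀ S : Finset ℕ, Separated S → ∀ θ : ℝ,
      ∑ s ∈ S, ∑ r ∈ Finset.range (2 ^ s), ‖dyadicPiece w γ (s + 3) (rot (2 ^ s) θ r)‖ ^ p ≤
        C + C' * offDiagonalSum w γ p S θ := by
  obtain ⟨c, hcsum, hc⟩ := hw.exists_expansion
  set σ : ℝ := ∑' q, ‖c q‖ ^ p with hσ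
  have hσ0 : 0 ≤ σ := tsum_nonneg fun _ => by positivity
  set M : ℝ := Real.sqrt 14 ^ p * (2 * σ) with hM
  refine ⟨M * ∑' j, sVal T j ^ p, M, by positivity, fun S hS θ => ?_⟩
  have hcB : 0 ≤ ∑' j, sVal T j ^ p + offDiagonalSum w γ p S θ :=
    add_nonneg (tsum_nonneg fun j => Real.rpow_nonneg (sVal_nonneg T j) _)
      (offDiagonalSum_nonneg _ _ _ _ _)
  rw [← mul_add]
  set cB := ∑' j, sVal T j ^ p + offDiagonalSum w γ p S θ with hcBdef
  rw [← sum_blockIndex S fun s r => ‖dyadicPiece w γ (s + 3) (rot (2 ^ s) θ r)‖ ^ p]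
  set d := 2 ^ (S.sup id + 4) with hd
  set ζ : BlockIndex S → ℂ := fun i => rot (2 ^ (i.1 : ℕ)) θ i.2 with hζ
  set F : BlockIndex S → ℂ := fun i => dyadicPiece w γ (i.1 + 3) (ζ i) with hF
  have hr : ∀ s ∈ S, ∀ t ∈ S, s ≠ t → Disjoint (rowBlock s) (rowBlock t) :=
    fun _ _ _ _ h => disjoint_rowBlock h
  have hcol : ∀ s ∈ S, ∀ t ∈ S, s ≠ t → Disjoint (colBlock s) (colBlock t) :=
    fun _ hs _ ht h => hS.disjoint_colBlock hs ht h
  have hζ1 : ∀ i, ‖ζ i‖ = 1 := fun i => norm_rot _ _ _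
  have hfreq : ∀ i i' : BlockIndex S, i.1 = i'.1 → i ≠ i' → (i.2 : ℕ) ≠ i'.2 := by
    rintro ⟨s, r⟩ ⟨s', r'⟩ h h'
    obtain rfl : s = s' := h
    exact fun e => h' (congrArg _ (Fin.ext e))
  set u : BlockIndex S → EuclideanSpace ℂ (Fin d) := fun i =>
    (((Real.sqrt (colBlock i.1).card)⁻¹ : ℝ) : ℂ) •
      ∑ k ∈ finBlock d (colBlock i.1), ζ i ^ (k : ℕ) • EuclideanSpace.single k (1 : ℂ) with hu
  have hu1 : Orthonormal ℂ u := by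
    refine orthonormal_finBlock (fun s hs => (subset_range_of_mem hs).2)
      (fun s => Finset.card_pos.1 (by rw [card_colBlock]; positivity)) hcol
      (fun i k => ζ i ^ k) (fun i k => by rw [norm_pow, hζ1, one_pow]) fun i i' h h' => ?_
    have hne := hfreq i i' h h'
    have hlt : (i'.2 : ℕ) < 2 ^ (i.1 : ℕ) := by rw [h]; exact i'.2.2
    have := sum_colBlock_conj_rot i.1 θ i.2.2 hlt hne
    simpa only [hζ, ← h] using this
  set X : BlockIndex S → EuclideanSpace ℂ (Fin d) := fun i =>
    (((Real.sqrt (rowBlock i.1).card)⁻¹ : ℝ) : ℂ) • ∑ k ∈ finBlock d (rowBlock i.1),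
      (starRingEnd ℂ) (ζ i ^ (k : ℕ)) • EuclideanSpace.single k (1 : ℂ) with hX
  have hX1 : Orthonormal ℂ X := by
    refine orthonormal_finBlock (fun s hs => (subset_range_of_mem hs).1)
      (fun s => Finset.card_pos.1 (by rw [card_rowBlock]; positivity)) hr
      (fun i k => (starRingEnd ℂ) (ζ i ^ k))
      (fun i k => by rw [RCLike.norm_conj, norm_pow, hζ1, one_pow]) fun i i' h h' => ?_
    have hne := hfreq i i' h h'
    have hlt : (i'.2 : ℕ) < 2 ^ (i.1 : ℕ) := by rw [h]; exact i'.2.2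
    have := congrArg (starRingEnd ℂ) (sum_rowBlock_conj_rot i.1 θ i.2.2 hlt hne)
    rw [map_sum, map_zero] at this
    simp only [map_mul] at this
    simpa only [hζ, ← h] using this
  set g : BlockIndex S → EuclideanSpace ℂ (Fin d) := fun i =>
    (((Real.sqrt 14)⁻¹ : ℝ) : ℂ) • F i • X i with hg
  set K : Fin d → Fin d → ℂ := fun j k => ∑ s ∈ S, ind (rowBlock s) j * ind (colBlock s) k *
    ((w (((j : ℕ) + k : ℕ) / 2 ^ (s + 3)) : ℂ) * γ (j + k)) with hK
  set KQ : Finset ℤ → Fin d → Fin d → ℂ := fun Q j k => ∑ s ∈ S,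
    ind (rowBlock s) j * ind (colBlock s) k *
      ((∑ q ∈ Q, c q * ept (q * (2 * Real.pi) / 2 ^ (s + 4)) ^ ((j : ℕ) + k)) * γ (j + k)) with hKQ
  have hgK : ∀ i j, g i j = ∑ k, K j k * u i k := by
    intro i j
    have hs : (i.1 : ℕ) ∈ S := i.1.2
    have e : ∀ k : Fin d, K j k * u i k = (((Real.sqrt (colBlock i.1).card)⁻¹ : ℝ) : ℂ) *
        ind (rowBlock i.1) j * (ind (colBlock i.1) k *
          ((w (((j : ℕ) + k : ℕ) / 2 ^ ((i.1 : ℕ) + 3)) : ℂ) * γ (j + k) * ζ i ^ (k : ℕ))) := by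
      intro k
      have e1 := ind_mul_sum_ind hcol (fun s => ind (rowBlock s) j *
        ((w (((j : ℕ) + k : ℕ) / 2 ^ (s + 3)) : ℂ) * γ (j + k))) k hs
      rw [hu, PiLp.smul_apply, sum_finBlock_single_apply, smul_eq_mul]
      calc _ = (((Real.sqrt (colBlock i.1).card)⁻¹ : ℝ) : ℂ) * ζ i ^ (k : ℕ) *
            (ind (colBlock i.1) k * ∑ t ∈ S, ind (colBlock t) k * (ind (rowBlock t) j *
              ((w (((j : ℕ) + k : ℕ) / 2 ^ (t + 3)) : ℂ) * γ (j + k)))) := by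
            have : K j k = ∑ t ∈ S, ind (colBlock t) k * (ind (rowBlock t) j *
              ((w (((j : ℕ) + k : ℕ) / 2 ^ (t + 3)) : ℂ) * γ (j + k))) :=
              Finset.sum_congr rfl fun _ _ => by ring
            rw [this]
            ring
        _ = _ := by rw [e1]; ring
    rw [Finset.sum_congr rfl fun k _ => e k, ← Finset.mul_sum,
      sum_fin_ind_mul (subset_range_of_mem hs).2
        (fun k => (w (((j : ℕ) + k : ℕ) / 2 ^ ((i.1 : ℕ) + 3)) : ℂ) * γ (j + k) * ζ i ^ (k : ℕ))]
    rw [hg, PiLp.smul_apply, PiLp.smul_apply, hX, PiLp.smul_apply, sum_finBlock_single_apply]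
    by_cases hj : (j : ℕ) ∈ rowBlock i.1
    swap
    · simp [ind_of_notMem hj]
    have hjlt : (j : ℕ) < 2 ^ ((i.1 : ℕ) + 1) := (Finset.mem_Ico.1 hj).2
    have e2 : F i = ζ i ^ (j : ℕ) * ∑ k ∈ colBlock i.1,
        (w (((j : ℕ) + k : ℕ) / 2 ^ ((i.1 : ℕ) + 3)) : ℂ) * γ (j + k) * ζ i ^ (k : ℕ) := by
      rw [hF]
      dsimp only
      rw [← sum_eq_dyadicPiece hw γ hjlt, Finset.mul_sum]
      exact Finset.sum_congr rfl fun k _ => by rw [pow_add]; ring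
    have e3 : (starRingEnd ℂ) (ζ i ^ (j : ℕ)) * ζ i ^ (j : ℕ) = 1 := by
      rw [← Complex.normSq_eq_conj_mul_self, Complex.normSq_eq_norm_sq, norm_pow, hζ1]; simp
    have e4 : (Real.sqrt (colBlock i.1).card)⁻¹ =
        (Real.sqrt 14)⁻¹ * (Real.sqrt (rowBlock i.1).card)⁻¹ := by
      rw [card_rowBlock, card_colBlock, ← mul_inv, ← Real.sqrt_mul (by norm_num)]
      push_cast
      rfl
    rw [e2, ind_of_mem hj, e4]
    simp only [smul_eq_mul, Complex.ofReal_mul, Complex.ofReal_inv]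
    linear_combination (((Real.sqrt 14 : ℝ) : ℂ)⁻¹ * ((Real.sqrt (rowBlock i.1).card : ℝ) : ℂ)⁻¹ *
      ∑ k ∈ colBlock i.1,
        (w (((j : ℕ) + k : ℕ) / 2 ^ ((i.1 : ℕ) + 3)) : ℂ) * γ (j + k) * ζ i ^ (k : ℕ)) * e3
  have hgorth : ∀ i i', i ≠ i' → inner ℂ (g i) (g i') = 0 := by
    intro i i' h
    simp only [hg, inner_smul_left, inner_smul_right, hX1.2 h, mul_zero]
  have hgnorm : ∀ i, ‖g i‖ ^ p = (Real.sqrt 14 ^ p)⁻¹ * ‖F i‖ ^ p := by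
    intro i
    rw [hg, norm_smul, norm_smul, hX1.1 i, mul_one, Complex.norm_real, Real.norm_of_nonneg
      (by positivity), Real.mul_rpow (by positivity) (norm_nonneg _), Real.inv_rpow (by positivity)]
  have hbound : ∀ Q, ∑ i, ‖g i‖ ^ p ≤ 2 * (σ * cB + ∑ j, ∑ k, ‖K j k - KQ Q j k‖ ^ p) := by
    intro Q
    have hQ := atomicLe_modulatedBlocks hw hp hp1 T hT hx hy hγ hS d θ c
      (fun q s => ept (q * (2 * Real.pi) / 2 ^ (s + 4))) (fun q s => norm_ept _) Q
    have hQ' := (hQ.add (AtomicLe.of_entries hp fun j k => K j k - KQ Q j k)).congr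
      (A' := K) (fun j k => (add_sub_cancel (KQ Q j k) (K j k)).symm)
    refine (hQ'.sum_norm_image_le hp hp1 u hu1 g hgK hgorth).trans ?_
    have : ∑ q ∈ Q, ‖c q‖ ^ p ≤ σ := (hcsum p hp).sum_le_tsum Q fun _ _ => by positivity
    gcongr
  have hlim : Filter.Tendsto (fun Q => 2 * (σ * cB + ∑ j, ∑ k, ‖K j k - KQ Q j k‖ ^ p))
      Filter.atTop (nhds (2 * (σ * cB + ∑ _j : Fin d, ∑ _k : Fin d, (0 : ℝ)))) := by
    refine Filter.Tendsto.const_mul _ (Filter.Tendsto.const_add _ ?_)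
    refine tendsto_finsetSum _ fun j _ => tendsto_finsetSum _ fun k _ => ?_
    have h1 : Filter.Tendsto (fun Q => KQ Q j k) Filter.atTop (nhds (K j k)) := by
      refine tendsto_finsetSum _ fun s _ => ?_
      by_cases hj : (j : ℕ) ∈ rowBlock s
      swap
      · simp [ind_of_notMem hj]
      by_cases hk : (k : ℕ) ∈ colBlock s
      swap
      · simp [ind_of_notMem hk]
      refine Filter.Tendsto.const_mul _ (Filter.Tendsto.mul_const _ ?_)
      refine hc s ((j : ℕ) + k) ?_ ?_
      · have := one_le_of_ind_rowBlock hj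
        omega
      · simp only [rowBlock, colBlock, Finset.mem_Ico] at hj hk
        rw [pow_succ] at hj
        rw [pow_add 2 s 4] at hk
        omega
    have h2 := ((tendsto_const_nhds (x := K j k)).sub h1).norm.rpow_const (p := p) (Or.inr hp.le)
    simpa [Real.zero_rpow hp.ne'] using h2
  have hfin := ge_of_tendsto' hlim hbound
  simp only [hgnorm, ← Finset.mul_sum, Finset.sum_const_zero, add_zero] at hfin
  rw [inv_mul_le_iff₀ (by positivity)] at hfin
  rw [hM]
  linarith

end SmallExponent

section Averaging

open MeasureTheory

/-- The `L^p`-mass of a dyadic piece, weighted by its frequency. -/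
def pieceMass (w : ℝ → ℝ) (γ : ℕ → ℂ) (p : ℝ) (m : ℕ) : ℝ :=
  2 ^ m * ∫ t in (0 : ℝ)..(2 * Real.pi), ‖dyadicPiece w γ m (ept t)‖ ^ p

lemma pieceMass_nonneg (w : ℝ → ℝ) (γ : ℕ → ℂ) (p : ℝ) (m : ℕ) : 0 ≤ pieceMass w γ p m :=
  mul_nonneg (by positivity) (intervalIntegral.integral_nonneg (by positivity) fun _ _ => by
    positivity)

lemma continuous_rot (n r : ℕ) : Continuous fun θ => rot n θ r := by
  unfold rot
  exact continuous_ept.comp (by fun_prop)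

lemma integral_sum_rot {h : ℂ → ℝ} (hh : Continuous h) {n : ℕ} :
    ∫ θ in (0 : ℝ)..(2 * Real.pi), ∑ r ∈ Finset.range n, h (rot n θ r) =
      n * ∫ θ in (0 : ℝ)..(2 * Real.pi), h (ept θ) := by
  have hper : Function.Periodic (fun t => h (ept t)) (2 * Real.pi) := by
    intro t
    simp only [ept_add, ept_two_pi, mul_one]
  have hintegrable : ∀ r ∈ Finset.range n, IntervalIntegrable (fun θ => h (rot n θ r)) volume 0
      (2 * Real.pi) := fun r _ => (hh.comp (continuous_rot n r)).intervalIntegrable _ _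
  rw [intervalIntegral.integral_finsetSum hintegrable]
  rw [Finset.sum_congr rfl (g := fun _ => ∫ θ in (0 : ℝ)..(2 * Real.pi), h (ept θ))]
  · rw [Finset.sum_const, Finset.card_range, nsmul_eq_mul]
  · intro r _
    have := intervalIntegral.integral_comp_add_right (a := 0) (b := 2 * Real.pi)
      (fun t => h (ept t)) (r * (2 * Real.pi / n))
    simp only [rot]
    rw [this, zero_add, add_comm (2 * Real.pi), hper.intervalIntegral_add_eq _ 0, zero_add]

lemma continuous_norm_dyadicPiece_rpow (w : ℝ → ℝ) (γ : ℕ → ℂ) {p : ℝ} (hp : 0 < p) (m : ℕ) :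
    Continuous fun z => ‖dyadicPiece w γ m z‖ ^ p :=
  (continuous_dyadicPiece w γ m).norm.rpow_const fun _ => Or.inr hp.le

lemma continuous_sampleSum (w : ℝ → ℝ) (γ : ℕ → ℂ) {p : ℝ} (hp : 0 < p) (u : ℕ) :
    Continuous (sampleSum w γ p u) := by
  unfold sampleSum
  exact continuous_finsetSum _ fun m _ => continuous_finsetSum _ fun r _ =>
    (continuous_norm_dyadicPiece_rpow w γ hp m).comp (continuous_rot _ r)

lemma integral_sampleSum_le (w : ℝ → ℝ) (γ : ℕ → ℂ) {p : ℝ} (hp : 0 < p) (u : ℕ) :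
    ∫ θ in (0 : ℝ)..(2 * Real.pi), sampleSum w γ p u θ ≤
      64 * ∑ m ∈ Finset.Ico u (u + 6), pieceMass w γ p m := by
  unfold sampleSum
  have hintegrable : ∀ m ∈ Finset.Ico u (u + 6), IntervalIntegrable (fun θ =>
      ∑ r ∈ Finset.range (2 ^ (u + 6)), ‖dyadicPiece w γ m (rot (2 ^ (u + 6)) θ r)‖ ^ p) volume 0
      (2 * Real.pi) := fun m _ => (continuous_finsetSum _ fun r _ =>
    (continuous_norm_dyadicPiece_rpow w γ hp m).comp (continuous_rot _ r)).intervalIntegrable _ _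
  rw [intervalIntegral.integral_finsetSum hintegrable, Finset.mul_sum]
  refine Finset.sum_le_sum fun m hm => ?_
  rw [integral_sum_rot (continuous_norm_dyadicPiece_rpow w γ hp m), pieceMass, ← mul_assoc]
  refine mul_le_mul_of_nonneg_right ?_ (intervalIntegral.integral_nonneg (by positivity)
    fun _ _ => by positivity)
  push_cast
  have : (2 : ℝ) ^ u ≤ 2 ^ m := pow_le_pow_right₀ (by norm_num) (Finset.mem_Ico.1 hm).1
  rw [pow_add]
  linarith

lemma sum_pieceMass_le {w : ℝ → ℝ} {γ : ℕ → ℂ} {p : ℝ} (hp : 0 < p) {C C' : ℝ} (hC' : 0 ≤ C')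
    {S : Finset ℕ} (h : ∀ θ : ℝ,
      ∑ s ∈ S, ∑ r ∈ Finset.range (2 ^ s), ‖dyadicPiece w γ (s + 3) (rot (2 ^ s) θ r)‖ ^ p ≤
        C + C' * offDiagonalSum w γ p S θ) :
    ∑ s ∈ S, pieceMass w γ p (s + 3) ≤ 16 * Real.pi * C + 512 * C' * ∑ s ∈ S, ∑ t ∈ S.erase s,
      ((Real.sqrt 2)⁻¹ ^ p) ^ (max s t - min s t) *
        ∑ m ∈ Finset.Ico (max s t) (max s t + 6), pieceMass w γ p m := by
  have hcont : Continuous fun θ => offDiagonalSum w γ p S θ := by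
    unfold offDiagonalSum
    exact continuous_finsetSum _ fun s _ => continuous_finsetSum _ fun t _ =>
      (continuous_sampleSum w γ hp _).const_mul _
  have hl : ∀ s ∈ S, Continuous fun θ => ∑ r ∈ Finset.range (2 ^ s),
      ‖dyadicPiece w γ (s + 3) (rot (2 ^ s) θ r)‖ ^ p := fun s _ =>
    continuous_finsetSum _ fun r _ =>
      (continuous_norm_dyadicPiece_rpow w γ hp _).comp (continuous_rot _ r)
  have h1 := intervalIntegral.integral_mono_on (μ := volume) (a := 0) (b := 2 * Real.pi)
    (by positivity) ((continuous_finsetSum S hl).intervalIntegrable _ _)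
    ((hcont.const_mul C').const_add C |>.intervalIntegrable _ _) fun θ _ => h θ
  rw [intervalIntegral.integral_finsetSum fun s hs => (hl s hs).intervalIntegrable _ _,
    intervalIntegral.integral_add (by simp) ((hcont.const_mul C').intervalIntegrable _ _),
    intervalIntegral.integral_const, intervalIntegral.integral_const_mul] at h1
  have e1 : ∀ s, pieceMass w γ p (s + 3) = 8 * ∫ θ in (0 : ℝ)..(2 * Real.pi),
      ∑ r ∈ Finset.range (2 ^ s), ‖dyadicPiece w γ (s + 3) (rot (2 ^ s) θ r)‖ ^ p := by
    intro s
    rw [integral_sum_rot (continuous_norm_dyadicPiece_rpow w γ hp (s + 3)), pieceMass, pow_add]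
    push_cast
    ring
  have e2 : ∫ θ in (0 : ℝ)..(2 * Real.pi), offDiagonalSum w γ p S θ ≤
      64 * ∑ s ∈ S, ∑ t ∈ S.erase s, ((Real.sqrt 2)⁻¹ ^ p) ^ (max s t - min s t) *
        ∑ m ∈ Finset.Ico (max s t) (max s t + 6), pieceMass w γ p m := by
    unfold offDiagonalSum
    rw [intervalIntegral.integral_finsetSum fun s _ => (continuous_finsetSum _ fun t _ =>
      (continuous_sampleSum w γ hp _).const_mul _).intervalIntegrable _ _, Finset.mul_sum]
    refine Finset.sum_le_sum fun s _ => ?_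
    rw [intervalIntegral.integral_finsetSum fun t _ =>
      ((continuous_sampleSum w γ hp _).const_mul _).intervalIntegrable _ _, Finset.mul_sum]
    refine Finset.sum_le_sum fun t _ => ?_
    rw [intervalIntegral.integral_const_mul, mul_left_comm]
    gcongr
    exact integral_sampleSum_le w γ hp _
  have e3 := mul_le_mul_of_nonneg_left e2 hC'
  simp_rw [e1, ← Finset.mul_sum]
  simp only [sub_zero, smul_eq_mul] at h1
  nlinarith

/-- Interactions between indices that are congruent modulo `M` decay geometrically in `M`. -/
lemma sum_congruent_pairs_le {ρ : ℝ} (hρ0 : 0 ≤ ρ) (hρ1 : ρ < 1) {b : ℕ → ℝ} (hb : ∀ u, 0 ≤ b u)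
    {M : ℕ} {S : Finset ℕ} (hS : ∀ s ∈ S, ∀ t ∈ S, s < t → s + M ≤ t) :
    ∑ s ∈ S, ∑ t ∈ S.erase s, ρ ^ (max s t - min s t) * b (max s t) ≤
      2 * (ρ ^ M * (1 - ρ)⁻¹) * ∑ s ∈ S, b s := by
  have hgeo : ∀ s ∈ S, ∑ t ∈ S, (if t < s then ρ ^ (s - t) else 0) ≤ ρ ^ M * (1 - ρ)⁻¹ := by
    intro s hs
    rw [← Finset.sum_filter]
    have hmem : ∀ t ∈ S.filter (· < s), t + M ≤ s := fun t ht =>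
      hS t (Finset.mem_filter.1 ht).1 s hs (Finset.mem_filter.1 ht).2
    rw [Finset.sum_congr rfl (g := fun t => ρ ^ M * ρ ^ (s - t - M)), ← Finset.mul_sum]
    · gcongr
      rw [← tsum_geometric_of_lt_one hρ0 hρ1,
        ← Finset.sum_image (s := S.filter (· < s)) (g := fun t => s - t - M) (f := fun n => ρ ^ n)]
      · exact (summable_geometric_of_lt_one hρ0 hρ1).sum_le_tsum _ fun _ _ => by positivity
      · intro t ht t' ht' h
        have h1 := hmem t ht
        have h2 := hmem t' ht'
        dsimp only at h
        omega
    · intro t ht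
      have := hmem t ht
      rw [← pow_add]
      congr 1
      omega
  have hsplit : ∀ s ∈ S, ∑ t ∈ S.erase s, ρ ^ (max s t - min s t) * b (max s t) =
      ∑ t ∈ S, (if t < s then ρ ^ (s - t) else 0) * b s +
        ∑ t ∈ S, (if s < t then ρ ^ (t - s) else 0) * b t := by
    intro s hs
    rw [← Finset.sum_add_distrib, ← Finset.add_sum_erase S _ hs]
    simp only [lt_irrefl, if_false, zero_mul, add_zero, zero_add]
    refine Finset.sum_congr rfl fun t ht => ?_
    rcases lt_or_gt_of_ne (Finset.ne_of_mem_erase ht) with h | h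
    · simp [h, h.le, h.not_gt]
    · simp [h, h.le, h.not_gt]
  rw [Finset.sum_congr rfl hsplit, Finset.sum_add_distrib, Finset.sum_comm (s := S) (t := S)
    (f := fun s t => (if s < t then ρ ^ (t - s) else 0) * b t), ← two_mul, mul_assoc]
  gcongr
  rw [Finset.mul_sum]
  refine Finset.sum_le_sum fun s hs => ?_
  rw [← Finset.sum_mul]
  exact mul_le_mul_of_nonneg_right (hgeo s hs) (hb s)

lemma summable_of_partialSum_bound {a : ℕ → ℝ} (ha : ∀ n, 0 ≤ a n) {C δ K R : ℝ} (hC : 0 ≤ C)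
    (hK : 0 ≤ K) (hR : 0 ≤ R) (hδ0 : 0 ≤ δ) (hδ : δ ≤ 1 / 2) (hδR : δ * R ^ 2 ≤ 1 / 2)
    (h1 : ∀ n, ∑ i ∈ Finset.range n, a i ≤ C + δ * ∑ i ∈ Finset.range (n + 2), a i)
    (h2 : ∀ n, ∑ i ∈ Finset.range n, a i ≤ K * R ^ n) : Summable a := by
  have h3 : ∀ k n : ℕ, ∑ i ∈ Finset.range n, a i ≤ 2 * C + (1 / 2) ^ k * (K * R ^ n) := by
    intro k
    induction k with
    | zero => intro n; rw [pow_zero, one_mul]; linarith [h2 n]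
    | succ k ih =>
      intro n
      have h4 : δ * ((1 / 2) ^ k * (K * R ^ (n + 2))) ≤ (1 / 2) ^ (k + 1) * (K * R ^ n) := by
        calc _ = (1 / 2) ^ k * (K * R ^ n) * (δ * R ^ 2) := by ring
          _ ≤ (1 / 2) ^ k * (K * R ^ n) * (1 / 2) := by gcongr
          _ = _ := by ring
      have h5 : δ * (2 * C) ≤ C := by nlinarith
      have h6 := mul_le_mul_of_nonneg_left (ih (n + 2)) hδ0
      linarith [h1 n]
  refine summable_of_sum_range_le (c := 2 * C) ha fun n => ?_
  refine ge_of_tendsto' (x := Filter.atTop)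
    (f := fun k : ℕ => 2 * C + (1 / 2 : ℝ) ^ k * (K * R ^ n)) ?_ fun k => h3 k n
  have := ((tendsto_pow_atTop_nhds_zero_of_lt_one (by norm_num : (0 : ℝ) ≤ 1 / 2)
    (by norm_num)).mul_const (K * R ^ n)).const_add (2 * C)
  simpa using this

lemma pieceMass_le {w : ℝ → ℝ} (hw : AdmissibleWeight w) {γ : ℕ → ℂ} {p : ℝ} (hp : 0 < p) {G : ℝ}
    (hG : ∀ l, ‖γ l‖ ≤ G) (m : ℕ) :
    pieceMass w γ p m ≤ 2 * Real.pi * (2 * G) ^ p * (2 * 2 ^ p) ^ m := by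
  have hG0 : 0 ≤ G := (norm_nonneg _).trans (hG 0)
  have h1 : ∀ t, ‖dyadicPiece w γ m (ept t)‖ ^ p ≤ (2 ^ (m + 1) * G) ^ p := by
    intro t
    refine Real.rpow_le_rpow (norm_nonneg _) ?_ hp.le
    refine (norm_sum_le _ _).trans ((Finset.sum_le_sum (g := fun _ => G) fun l _ => ?_).trans ?_)
    · rw [norm_mul, norm_mul, norm_pow, norm_ept, one_pow, mul_one, Complex.norm_real,
        Real.norm_of_nonneg (hw.2.1 _)]
      exact (mul_le_of_le_one_left (norm_nonneg _) (hw.le_one _)).trans (hG l)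
    · simp
  have h2 := intervalIntegral.integral_mono_on (μ := volume) (a := 0) (b := 2 * Real.pi)
    (by positivity) (((continuous_norm_dyadicPiece_rpow w γ hp m).comp
      continuous_ept).intervalIntegrable _ _) (by simp) fun t _ => h1 t
  rw [intervalIntegral.integral_const, smul_eq_mul, sub_zero] at h2
  unfold pieceMass
  refine (mul_le_mul_of_nonneg_left h2 (by positivity)).trans (le_of_eq ?_)
  have h3 : ((2 : ℝ) ^ (m + 1) * G) ^ p = (2 ^ p) ^ m * (2 * G) ^ p := by
    rw [pow_succ, mul_assoc, Real.mul_rpow (by positivity) (by positivity), ← Real.rpow_natCast,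
      ← Real.rpow_mul (by norm_num), mul_comm (m : ℝ), Real.rpow_mul (by norm_num),
      Real.rpow_natCast]
  rw [h3, mul_pow]
  ring

end Averaging

section Core

variable {H : Type} [NormedAddCommGroup H] [InnerProductSpace ℂ H] [CompleteSpace H]

/-- If a Hankel matrix is the matrix of an operator of class `S_p`, then the dyadic pieces of its
symbol satisfy the Besov condition of order `1/p`. -/
theorem summable_pieceMass {w : ℝ → ℝ} (hw : AdmissibleWeight w) {p : ℝ} (hp : 0 < p)
    (T : H →L[ℂ] H) (hT : MemSchatten p T) {x y : ℕ → H} (hx : Orthonormal ℂ x)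
    (hy : Orthonormal ℂ y) {γ : ℕ → ℂ}
    (hγ : ∀ j k, 1 ≤ j → 1 ≤ k → inner ℂ (x j) (T (y k)) = γ (j + k)) :
    Summable (pieceMass w γ p) := by
  obtain ⟨C, C', hC', hsamples⟩ : ∃ C C' : ℝ, 0 ≤ C' ∧ ∀ S : Finset ℕ, Separated S → ∀ θ : ℝ,
      ∑ s ∈ S, ∑ r ∈ Finset.range (2 ^ s), ‖dyadicPiece w γ (s + 3) (rot (2 ^ s) θ r)‖ ^ p ≤
        C + C' * offDiagonalSum w γ p S θ := by
    rcases le_total p 1 with h | h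
    · exact sum_samples_le_of_le_one hw hp h T hT hx hy hγ
    · obtain ⟨C, hC⟩ := sum_samples_le_of_one_le hw h T hT hx hy hγ
      exact ⟨C, 0, le_rfl, fun S hS θ => by rw [zero_mul, add_zero]; exact hC S hS θ⟩
  obtain ⟨G, hG⟩ : ∃ G : ℝ, ∀ l, ‖γ l‖ ≤ G := by
    refine ⟨‖T‖ + ‖γ 0‖ + ‖γ 1‖, fun l => ?_⟩
    have h0 := norm_nonneg T
    have h1 := norm_nonneg (γ 0)
    have h2 := norm_nonneg (γ 1)
    match l with
    | 0 => linarith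
    | 1 => linarith
    | l + 2 =>
      have := hγ 1 (l + 1) le_rfl (by omega)
      rw [show l + 2 = 1 + (l + 1) by ring, ← this]
      refine (norm_inner_le_norm _ _).trans ?_
      rw [hx.1, one_mul]
      have := T.le_opNorm (y (l + 1))
      rw [hy.1, mul_one] at this
      linarith
  set ρ : ℝ := (Real.sqrt 2)⁻¹ ^ p with hρ
  have hρ0 : 0 ≤ ρ := by positivity
  have hρ1 : ρ < 1 := Real.rpow_lt_one (by positivity)
    (inv_lt_one_of_one_lt₀ (Real.lt_sqrt_of_sq_lt (by norm_num))) hp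
  set a := pieceMass w γ p with ha
  have ha0 : ∀ n, 0 ≤ a n := pieceMass_nonneg w γ p
  set b : ℕ → ℝ := fun u => ∑ m ∈ Finset.Ico u (u + 6), a m with hb
  have hb0 : ∀ u, 0 ≤ b u := fun u => Finset.sum_nonneg fun m _ => ha0 m
  set R : ℝ := 2 * 2 ^ p with hR
  have hR2 : 2 ≤ R := by
    have := Real.one_le_rpow (by norm_num : (1 : ℝ) ≤ 2) hp.le
    linarith
  set L : ℝ := 512 * C' * (2 * (1 - ρ)⁻¹) * 6 with hL
  have hρ' : 0 < (1 - ρ)⁻¹ := inv_pos.2 (by linarith)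
  have hL0 : 0 ≤ L := by positivity
  obtain ⟨M, hM4, hMδ⟩ : ∃ M : ℕ, 4 ≤ M ∧ ρ ^ M * (L * R ^ 2) ≤ 1 / 2 := by
    have h1 := (tendsto_pow_atTop_nhds_zero_of_lt_one hρ0 hρ1).mul_const (L * R ^ 2)
    rw [zero_mul] at h1
    obtain ⟨M, h2, h3⟩ := ((h1.eventually_lt_const (by norm_num : (0 : ℝ) < 1 / 2)).and
      (Filter.eventually_ge_atTop 4)).exists
    exact ⟨M, h3, h2.le⟩
  have hres : ∀ N r, ∑ s ∈ (Finset.range N).filter (fun s => s % M = r), a (s + 3) ≤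
      16 * Real.pi * C + 512 * C' * (2 * (ρ ^ M * (1 - ρ)⁻¹) *
        ∑ s ∈ (Finset.range N).filter (fun s => s % M = r), b s) := by
    intro N r
    have hgap : ∀ s ∈ (Finset.range N).filter (fun s => s % M = r),
        ∀ t ∈ (Finset.range N).filter (fun s => s % M = r), s < t → s + M ≤ t := by
      intro s hs t ht hst
      have h1 : s ≡ t [MOD M] := (Finset.mem_filter.1 hs).2.trans (Finset.mem_filter.1 ht).2.symm
      have h2 := Nat.le_of_dvd (by omega) ((Nat.modEq_iff_dvd' hst.le).1 h1)
      omega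
    have hsep : Separated ((Finset.range N).filter fun s => s % M = r) := fun s hs t ht h =>
      (by omega : s + 4 ≤ s + M).trans (hgap s hs t ht h)
    refine (sum_pieceMass_le hp hC' (hsamples _ hsep)).trans ?_
    gcongr
    exact sum_congruent_pairs_le hρ0 hρ1 hb0 hgap
  have hfib : ∀ (N : ℕ) (g : ℕ → ℝ), ∑ r ∈ Finset.range M,
      ∑ s ∈ (Finset.range N).filter (fun s => s % M = r), g s = ∑ s ∈ Finset.range N, g s :=
    fun N g => Finset.sum_fiberwise_of_maps_to
      (fun s _ => Finset.mem_range.2 (Nat.mod_lt s (by omega))) g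
  have hbsum : ∀ N, ∑ s ∈ Finset.range N, b s ≤ 6 * ∑ m ∈ Finset.range (N + 5), a m := by
    intro N
    have e : ∀ u, b u = ∑ i ∈ Finset.range 6, a (u + i) := fun u => by
      rw [hb]
      dsimp only
      rw [Finset.sum_Ico_eq_sum_range, Nat.add_sub_cancel_left]
    simp_rw [e]
    rw [Finset.sum_comm]
    refine (Finset.sum_le_card_nsmul _ _ (∑ m ∈ Finset.range (N + 5), a m) fun i hi => ?_).trans
      (by simp)
    rw [Finset.mem_range] at hi
    rw [← Finset.sum_image (f := a) (g := fun u => u + i) (fun _ _ _ _ h => by simpa using h)]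
    refine Finset.sum_le_sum_of_subset_of_nonneg ?_ fun m _ _ => ha0 m
    intro m hm
    simp only [Finset.mem_image, Finset.mem_range] at hm ⊢
    omega
  set δ : ℝ := ρ ^ M * L with hδ
  set D : ℝ := |M * (16 * Real.pi * C)| + ∑ i ∈ Finset.range 3, a i with hD
  have hD0 : 0 ≤ ∑ i ∈ Finset.range 3, a i := Finset.sum_nonneg fun i _ => ha0 i
  have hδ0 : 0 ≤ δ := by positivity
  have hA0 : ∀ n, 0 ≤ ∑ i ∈ Finset.range n, a i := fun n => Finset.sum_nonneg fun i _ => ha0 i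
  have hδR : δ * R ^ 2 ≤ 1 / 2 := by rw [hδ, mul_assoc]; exact hMδ
  refine summable_of_partialSum_bound ha0 (C := D) (δ := δ) (R := R)
    (K := 2 * Real.pi * (2 * G) ^ p) (by positivity) ?_ (by positivity) hδ0 ?_ hδR ?_ ?_
  · have hG0 : 0 ≤ G := (norm_nonneg _).trans (hG 0)
    positivity
  · nlinarith [mul_le_mul_of_nonneg_left hR2 hδ0]
  · intro n
    rcases lt_or_ge n 3 with hn | hn
    · have h1 : ∑ i ∈ Finset.range n, a i ≤ ∑ i ∈ Finset.range 3, a i :=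
        Finset.sum_le_sum_of_subset_of_nonneg (Finset.range_subset_range.2 hn.le)
          fun i _ _ => ha0 i
      have h2 := mul_nonneg hδ0 (hA0 (n + 2))
      have h3 := abs_nonneg (M * (16 * Real.pi * C))
      linarith
    · obtain ⟨N, rfl⟩ := Nat.exists_eq_add_of_le hn
      have h1 : ∑ s ∈ Finset.range N, a (s + 3) ≤ M * (16 * Real.pi * C) +
          512 * C' * (2 * (ρ ^ M * (1 - ρ)⁻¹) * ∑ s ∈ Finset.range N, b s) := by
        have := Finset.sum_le_sum fun r (_ : r ∈ Finset.range M) => hres N r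
        rw [hfib N fun s => a (s + 3), Finset.sum_add_distrib, Finset.sum_const,
          Finset.card_range, nsmul_eq_mul, ← Finset.mul_sum, ← Finset.mul_sum, hfib N b] at this
        exact this
      have h2 : 512 * C' * (2 * (ρ ^ M * (1 - ρ)⁻¹) * ∑ s ∈ Finset.range N, b s) ≤
          δ * ∑ i ∈ Finset.range (3 + N + 2), a i := by
        calc _ ≤ 512 * C' * (2 * (ρ ^ M * (1 - ρ)⁻¹) * (6 * ∑ m ∈ Finset.range (N + 5), a m)) := by
              gcongr
              exact hbsum N
          _ = _ := by rw [hδ, hL, show 3 + N + 2 = N + 5 by ring]; ring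
      rw [Finset.sum_range_add]
      simp_rw [add_comm 3 (_ : ℕ)] at *
      have h3 := le_abs_self (M * (16 * Real.pi * C))
      linarith
  · intro n
    induction n with
    | zero =>
      have hG0 : 0 ≤ G := (norm_nonneg _).trans (hG 0)
      simp
      positivity
    | succ n ih =>
      have hG0 : 0 ≤ G := (norm_nonneg _).trans (hG 0)
      rw [Finset.sum_range_succ, pow_succ]
      have h1 : a n ≤ 2 * Real.pi * (2 * G) ^ p * R ^ n := pieceMass_le hw hp hG n
      have h2 : 0 ≤ 2 * Real.pi * (2 * G) ^ p * R ^ n := by positivity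
      nlinarith

end Core

section Spectral

open MeasureTheory

/-- The Fourier coefficients of a function on the unit circle. -/
def fhat (f : ℂ → ℂ) (n : ℤ) : ℂ :=
  (2 * Real.pi)⁻¹ • ∫ t in (0 : ℝ)..(2 * Real.pi), f (ept t) * (ept t ^ n)⁻¹

lemma continuous_comp_ept {f : ℂ → ℂ} (hf : ContinuousOn f (Metric.sphere (0 : ℂ) 1)) :
    Continuous fun t => f (ept t) :=
  hf.comp_continuous continuous_ept fun t => by simp [norm_ept]

lemma ept_zpow (t : ℝ) (n : ℤ) : ept t ^ n = ept (n * t) := by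
  rw [ept, ept, ← Complex.exp_int_mul]
  congr 1
  push_cast
  ring

lemma inv_ept (t : ℝ) : (ept t)⁻¹ = ept (-t) := by
  rw [ept, ept, ← Complex.exp_neg]
  congr 1
  push_cast
  ring

lemma continuous_ept_zpow (n : ℤ) : Continuous fun t => ept t ^ n := by
  simp_rw [ept_zpow]
  exact continuous_ept.comp (by fun_prop)

lemma continuous_inv_ept_zpow (n : ℤ) : Continuous fun t => (ept t ^ n)⁻¹ := by
  simp_rw [ept_zpow, inv_ept]
  exact continuous_ept.comp (by fun_prop)

lemma fhat_zpow (m n : ℤ) : fhat (fun z => z ^ m) n = if m = n then 1 else 0 := by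
  unfold fhat
  have h : ∀ t : ℝ, ept t ^ m * (ept t ^ n)⁻¹ = Complex.exp (((m - n : ℤ) * Complex.I) * t) := by
    intro t
    rw [← zpow_neg, ← zpow_add₀ (ept_ne_zero t), ept_zpow, ept]
    congr 1
    push_cast
    ring
  simp_rw [h]
  split_ifs with hmn
  · subst hmn
    simp only [sub_self, Int.cast_zero, zero_mul, Complex.exp_zero,
      intervalIntegral.integral_const, sub_zero, smul_smul]
    rw [inv_mul_cancel₀ (by positivity), one_smul]
  · have h0 : (((m - n : ℤ) : ℂ) * Complex.I) ≠ 0 :=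
      mul_ne_zero (by exact_mod_cast sub_ne_zero.2 hmn) Complex.I_ne_zero
    rw [integral_exp_mul_complex h0]
    have h1 : Complex.exp (((m - n : ℤ) : ℂ) * Complex.I * ((2 * Real.pi : ℝ) : ℂ)) = 1 := by
      rw [Complex.exp_eq_one_iff]
      exact ⟨m - n, by push_cast; ring⟩
    rw [h1]
    simp

lemma exists_trigPolynomial_near {f : ℂ → ℂ} (hf : ContinuousOn f (Metric.sphere (0 : ℂ) 1))
    {ε : ℝ} (hε : 0 < ε) :
    ∃ (N : Finset ℤ) (c : ℤ → ℂ), ∀ t : ℝ, ‖f (ept t) - ∑ n ∈ N, c n * ept t ^ n‖ ≤ ε := by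
  have : Fact (0 < 2 * Real.pi) := ⟨by positivity⟩
  set F : C(AddCircle (2 * Real.pi), ℂ) := ⟨fun x => f (AddCircle.toCircle x),
    hf.comp_continuous (continuous_subtype_val.comp AddCircle.continuous_toCircle)
      fun x => by simp [Circle.norm_coe]⟩ with hF
  have hmem : F ∈ closure (Submodule.span ℂ (Set.range (@fourier (2 * Real.pi))) : Set _) := by
    rw [← Submodule.topologicalClosure_coe, span_fourier_closure_eq_top]
    trivial
  obtain ⟨g, hg, hgF⟩ := Metric.mem_closure_iff.1 hmem ε hε
  obtain ⟨c, rfl⟩ := Finsupp.mem_span_range_iff_exists_finsupp.1 hg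
  refine ⟨c.support, c, fun t => ?_⟩
  have hpt : ((AddCircle.toCircle (t : AddCircle (2 * Real.pi)) : Circle) : ℂ) = ept t := by
    rw [AddCircle.toCircle_apply_mk, Circle.coe_exp, ept, div_self (by positivity), one_mul]
  have h1 := (F - c.sum fun i a => a • fourier i).norm_coe_le_norm (t : AddCircle (2 * Real.pi))
  rw [← dist_eq_norm] at h1
  refine (le_of_eq ?_).trans (h1.trans hgF.le)
  congr 1
  rw [ContinuousMap.sub_apply, hF, ContinuousMap.coe_mk, hpt, Finsupp.sum,
    ContinuousMap.coe_sum, Finset.sum_apply]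
  congr 1
  refine Finset.sum_congr rfl fun n _ => ?_
  rw [ContinuousMap.smul_apply, smul_eq_mul, fourier_apply, AddCircle.toCircle_zsmul,
    Circle.coe_zpow, hpt]

variable {H : Type} [NormedAddCommGroup H] [InnerProductSpace ℂ H]

lemma zpow_apply_of_shift {e : ℤ → H} (U : (H →L[ℂ] H)ˣ)
    (hU : ∀ k, (U : H →L[ℂ] H) (e k) = e (k + 1)) (n k : ℤ) :
    ((U ^ n : (H →L[ℂ] H)ˣ) : H →L[ℂ] H) (e k) = e (k + n) := by
  have hinv : ∀ k, ((U⁻¹ : (H →L[ℂ] H)ˣ) : H →L[ℂ] H) (e k) = e (k - 1) := by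
    intro k
    have h := hU (k - 1)
    rw [sub_add_cancel] at h
    rw [← h, ← mul_apply_eq_comp, ← Units.val_mul, inv_mul_cancel]
    rfl
  induction n using Int.induction_on with
  | zero => simp
  | succ n ih =>
    rw [add_comm, zpow_one_add, Units.val_mul, mul_apply_eq_comp, ih, hU]
    congr 1
    ring
  | pred n ih =>
    rw [sub_eq_neg_add, zpow_add, zpow_neg_one, Units.val_mul, mul_apply_eq_comp, ih,
      hinv]
    congr 1
    ring

variable [CompleteSpace H]

lemma norm_cfc_sub_le {f g : ℂ → ℂ} (hf : ContinuousOn f (Metric.sphere (0 : ℂ) 1))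
    (hg : ContinuousOn g (Metric.sphere (0 : ℂ) 1)) {ε : ℝ} (hε : 0 ≤ ε)
    (h : ∀ t : ℝ, ‖f (ept t) - g (ept t)‖ ≤ ε) {U : H →L[ℂ] H} (hU : U ∈ unitary (H →L[ℂ] H)) :
    ‖cfc f U - cfc g U‖ ≤ ε := by
  have hs : spectrum ℂ U ⊆ Metric.sphere (0 : ℂ) 1 := spectrum.subset_circle_of_unitary hU
  have hn : IsStarNormal U := ⟨by
    rw [commute_iff_eq, (Unitary.mem_iff.1 hU).1, (Unitary.mem_iff.1 hU).2]⟩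
  rw [← cfc_sub f g U (hf.mono hs) (hg.mono hs)]
  refine norm_cfc_le hε fun z hz => ?_
  have hz1 : ‖z‖ = 1 := by simpa using hs hz
  have hzt : z = ept z.arg := by
    have := Complex.norm_mul_exp_arg_mul_I z
    rw [hz1, Complex.ofReal_one, one_mul] at this
    exact this.symm
  rw [hzt]
  exact h _

lemma norm_fhat_sub_le {f g : ℂ → ℂ} (hf : Continuous fun t => f (ept t))
    (hg : Continuous fun t => g (ept t)) {ε : ℝ}
    (h : ∀ t : ℝ, ‖f (ept t) - g (ept t)‖ ≤ ε) (n : ℤ) : ‖fhat f n - fhat g n‖ ≤ ε := by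
  have hintegrable : ∀ {g : ℂ → ℂ}, Continuous (fun t => g (ept t)) → IntervalIntegrable
      (fun t => g (ept t) * (ept t ^ n)⁻¹) volume 0 (2 * Real.pi) :=
    fun h => (h.mul (continuous_inv_ept_zpow n)).intervalIntegrable _ _
  rw [fhat, fhat, ← smul_sub, ← intervalIntegral.integral_sub (hintegrable hf) (hintegrable hg), norm_smul]
  have h1 : ‖∫ t in (0 : ℝ)..(2 * Real.pi),
      (f (ept t) * (ept t ^ n)⁻¹ - g (ept t) * (ept t ^ n)⁻¹)‖ ≤ ε * |2 * Real.pi - 0| := by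
    refine intervalIntegral.norm_integral_le_of_norm_le_const fun t _ => ?_
    rw [← sub_mul, norm_mul, norm_inv, norm_zpow, norm_ept, one_zpow, inv_one, mul_one]
    exact h t
  rw [sub_zero, abs_of_pos (by positivity)] at h1
  rw [Real.norm_of_nonneg (by positivity)]
  calc _ ≤ (2 * Real.pi)⁻¹ * (ε * (2 * Real.pi)) := by gcongr
    _ = ε := by field_simp

lemma fhat_trigPolynomial (N : Finset ℤ) (c : ℤ → ℂ) (n : ℤ) :
    fhat (fun z => ∑ m ∈ N, c m * z ^ m) n = ∑ m ∈ N, c m * (if m = n then 1 else 0) := by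
  have hintegrable : ∀ m ∈ N, IntervalIntegrable (fun t => c m * ept t ^ m * (ept t ^ n)⁻¹)
      volume 0 (2 * Real.pi) := fun m _ =>
    ((continuous_const.mul (continuous_ept_zpow m)).mul
      (continuous_inv_ept_zpow n)).intervalIntegrable _ _
  simp_rw [← fhat_zpow, fhat, Finset.sum_mul]
  rw [intervalIntegral.integral_finsetSum hintegrable, Finset.smul_sum]
  refine Finset.sum_congr rfl fun m _ => ?_
  simp_rw [mul_assoc]
  rw [intervalIntegral.integral_const_mul, mul_smul_comm]

lemma continuousOn_trigPolynomial (N : Finset ℤ) (c : ℤ → ℂ) :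
    ContinuousOn (fun z : ℂ => ∑ m ∈ N, c m * z ^ m) (Metric.sphere (0 : ℂ) 1) := by
  refine continuousOn_finsetSum _ fun m _ => continuousOn_const.mul ?_
  refine fun z hz => (continuousAt_zpow₀ z m (Or.inl ?_)).continuousWithinAt
  rintro rfl
  simp at hz

lemma inner_cfc_of_shift {f : ℂ → ℂ} (hf : ContinuousOn f (Metric.sphere (0 : ℂ) 1))
    {U : H →L[ℂ] H} (hU : U ∈ unitary (H →L[ℂ] H)) {e : ℤ → H} (he : Orthonormal ℂ e)
    (hshift : ∀ k, U (e k) = e (k + 1)) (j k : ℤ) :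
    inner ℂ (e j) (cfc f U (e k)) = fhat f (j - k) := by
  have hs : spectrum ℂ U ⊆ Metric.sphere (0 : ℂ) 1 := spectrum.subset_circle_of_unitary hU
  have hn : IsStarNormal U := ⟨by
    rw [commute_iff_eq, (Unitary.mem_iff.1 hU).1, (Unitary.mem_iff.1 hU).2]⟩
  have htrig : ∀ (N : Finset ℤ) (c : ℤ → ℂ),
      inner ℂ (e j) (cfc (fun z : ℂ => ∑ m ∈ N, c m * z ^ m) U (e k)) =
        fhat (fun z => ∑ m ∈ N, c m * z ^ m) (j - k) := by
    intro N c
    have hc : ∀ m : ℤ, ContinuousOn (fun z : ℂ => z ^ m) (spectrum ℂ U) := by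
      intro m
      simpa using (continuousOn_trigPolynomial {m} fun _ => 1).mono hs
    have hz : ∀ m : ℤ, inner ℂ (e j) (cfc (fun z : ℂ => z ^ m) U (e k)) =
        if m = j - k then 1 else 0 := by
      intro m
      have h1 := cfc_zpow (R := ℂ) (Unitary.toUnits ⟨U, hU⟩) m hn
      have h2 : ((Unitary.toUnits ⟨U, hU⟩ : (H →L[ℂ] H)ˣ) : H →L[ℂ] H) = U := rfl
      rw [h2] at h1
      rw [h1, zpow_apply_of_shift _ hshift, orthonormal_iff_ite.1 he]
      congr 1
      exact propext ⟨fun h => by omega, fun h => by omega⟩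
    rw [fhat_trigPolynomial]
    have h3 : (fun z : ℂ => ∑ m ∈ N, c m * z ^ m) = ∑ m ∈ N, fun z : ℂ => c m * z ^ m := by
      ext z
      simp
    have h4 : ∀ m ∈ N, ContinuousOn (fun z : ℂ => c m * z ^ m) (spectrum ℂ U) :=
      fun m _ => continuousOn_const.mul (hc m)
    rw [h3, cfc_sum _ _ _ h4,
      sum_apply, inner_sum]
    refine Finset.sum_congr rfl fun m _ => ?_
    rw [cfc_const_mul _ _ _ (hc m), smul_apply, inner_smul_right, hz]
  refine eq_of_forall_dist_le fun ε hε => ?_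
  obtain ⟨N, c, hNc⟩ := exists_trigPolynomial_near hf (half_pos hε)
  have hg := continuousOn_trigPolynomial N c
  have h1 := norm_cfc_sub_le hf hg (half_pos hε).le hNc hU
  have h2 := norm_fhat_sub_le (continuous_comp_ept hf) (continuous_comp_ept hg) hNc (j - k)
  rw [← htrig] at h2
  have h3 : ‖inner ℂ (e j) (cfc f U (e k)) -
      inner ℂ (e j) (cfc (fun z : ℂ => ∑ m ∈ N, c m * z ^ m) U (e k))‖ ≤ ε / 2 := by
    rw [← inner_sub_right, ← sub_apply]
    refine (norm_inner_le_norm _ _).trans ?_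
    rw [he.1, one_mul]
    refine (ContinuousLinearMap.le_opNorm _ _).trans ?_
    rwa [he.1, mul_one]
  rw [dist_eq_norm]
  rw [norm_sub_rev] at h2
  refine (norm_sub_le_norm_sub_add_norm_sub _ _ _).trans ((add_le_add h3 h2).trans_eq ?_)
  ring

end Spectral

section Shifts

variable {H : Type} [NormedAddCommGroup H] [InnerProductSpace ℂ H]

lemma HilbertBasis.separableSpace (b : HilbertBasis ℤ ℂ H) :
    TopologicalSpace.SeparableSpace H := by
  have h := ((Set.countable_range b).isSeparable.span (R := ℂ)).closure
  have hd : closure (Submodule.span ℂ (Set.range b) : Set H) = Set.univ := by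
    rw [← Submodule.topologicalClosure_coe, b.dense_span]
    rfl
  rw [hd] at h
  exact TopologicalSpace.isSeparable_univ_iff.1 h

/-- The sign of an integer, with value `1` at zero. -/
def halfSign (k : ℤ) : ℂ := if 0 ≤ k then 1 else -1

lemma halfSign_mul_self (k : ℤ) : halfSign k * halfSign k = 1 := by
  unfold halfSign
  split_ifs <;> norm_num

lemma conj_halfSign (k : ℤ) : (starRingEnd ℂ) (halfSign k) = halfSign k := by
  unfold halfSign
  split_ifs <;> simp

lemma rank_shift_sub_signed_shift (b c : HilbertBasis ℤ ℂ H) (hc : ∀ k, c k = halfSign k • b k)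
    {U V : H →L[ℂ] H} (hU : ∀ k, U (b k) = b (k + 1)) (hV : ∀ k, V (c k) = c (k + 1)) :
    LinearMap.rank ((U - V : H →L[ℂ] H) : H →ₗ[ℂ] H) = 1 := by
  have hb : ∀ k, b k = halfSign k • c k := by
    intro k
    rw [hc, smul_smul, halfSign_mul_self, one_smul]
  have h : U - V = (innerSL ℂ (b (-1))).smulRight ((2 : ℂ) • b 0) := by
    refine ContinuousLinearMap.ext_on (s := Set.range b) ?_ ?_
    · rw [dense_iff_closure_eq, ← Submodule.topologicalClosure_coe, b.dense_span]
      rfl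
    · rintro _ ⟨k, rfl⟩
      have hVb : V (b k) = (halfSign k * halfSign (k + 1)) • b (k + 1) := by
        rw [hb k, map_smul, hV, hc (k + 1), smul_smul]
      rw [sub_apply, hU, hVb, ContinuousLinearMap.smulRight_apply, innerSL_apply_apply,
        orthonormal_iff_ite.1 b.orthonormal]
      by_cases hk : -1 = k
      · subst hk
        norm_num [halfSign]
        module
      · have h1 : halfSign k * halfSign (k + 1) = 1 := by
          unfold halfSign
          split_ifs <;> first | omega | norm_num
        rw [h1, if_neg hk]
        simp
  have hb0 : (2 : ℂ) • b 0 ≠ 0 := smul_ne_zero two_ne_zero (b.orthonormal.ne_zero 0)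
  have hr : LinearMap.range ((U - V : H →L[ℂ] H) : H →ₗ[ℂ] H) =
      Submodule.span ℂ {(2 : ℂ) • b 0} := by
    ext v
    rw [Submodule.mem_span_singleton, LinearMap.mem_range, h]
    constructor
    · rintro ⟨x, rfl⟩
      exact ⟨_, rfl⟩
    · rintro ⟨a, rfl⟩
      refine ⟨a • b (-1), ?_⟩
      simp [b.orthonormal.1 (-1)]
  rw [LinearMap.rank, hr, rank_submodule_eq_one_iff]
  exact ⟨_, Submodule.mem_span_singleton_self _, hb0, le_rfl⟩

variable [CompleteSpace H]

lemma HilbertBasis.exists_unitary_shift (b : HilbertBasis ℤ ℂ H) :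
    ∃ U ∈ unitary (H →L[ℂ] H), ∀ k, U (b k) = b (k + 1) := by
  have hd : ⊤ ≤ (Submodule.span ℂ (Set.range fun k => b (k + 1))).topologicalClosure := by
    rw [show (fun k => b (k + 1)) = b ∘ (Equiv.addRight (1 : ℤ)) from rfl, Set.range_comp,
      Equiv.range_eq_univ, Set.image_univ, b.dense_span]
  set d := HilbertBasis.mk (b.orthonormal.comp (fun k : ℤ => k + 1) (add_left_injective 1)) hd
  refine ⟨Unitary.linearIsometryEquiv.symm (b.repr.trans d.repr.symm), Subtype.property _,
    fun k => ?_⟩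
  change d.repr.symm (b.repr (b k)) = _
  rw [b.repr_self, d.repr_symm_single, HilbertBasis.coe_mk]
  rfl

lemma HilbertBasis.exists_halfSign_smul (b : HilbertBasis ℤ ℂ H) :
    ∃ c : HilbertBasis ℤ ℂ H, ∀ k, c k = halfSign k • b k := by
  have ho : Orthonormal ℂ fun k => halfSign k • b k := by
    rw [orthonormal_iff_ite]
    intro i j
    rw [inner_smul_left, inner_smul_right, orthonormal_iff_ite.1 b.orthonormal, conj_halfSign]
    split_ifs with hij
    · rw [hij, mul_one, halfSign_mul_self]
    · simp
  have hd : ⊤ ≤ (Submodule.span ℂ (Set.range fun k => halfSign k • b k)).topologicalClosure := by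
    rw [← b.dense_span]
    refine Submodule.topologicalClosure_mono (Submodule.span_le.2 ?_)
    rintro _ ⟨k, rfl⟩
    have h : b k = halfSign k • (halfSign k • b k) := by
      rw [smul_smul, halfSign_mul_self, one_smul]
    rw [h]
    exact Submodule.smul_mem _ _ (Submodule.subset_span ⟨k, rfl⟩)
  exact ⟨HilbertBasis.mk ho hd, fun k => by rw [HilbertBasis.coe_mk]⟩

lemma inner_cfc_sub_cfc_of_shifts {f : ℂ → ℂ} (hf : ContinuousOn f (Metric.sphere (0 : ℂ) 1))
    (b c : HilbertBasis ℤ ℂ H) (hc : ∀ k, c k = halfSign k • b k)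
    {U V : H →L[ℂ] H} (hUu : U ∈ unitary (H →L[ℂ] H)) (hVu : V ∈ unitary (H →L[ℂ] H))
    (hU : ∀ k, U (b k) = b (k + 1)) (hV : ∀ k, V (c k) = c (k + 1)) (j k : ℤ) :
    inner ℂ (b j) ((cfc f U - cfc f V) (b k)) =
      (1 - halfSign j * halfSign k) * fhat f (j - k) := by
  have hb : ∀ k, b k = halfSign k • c k := by
    intro k
    rw [hc, smul_smul, halfSign_mul_self, one_smul]
  have h2 : inner ℂ (b j) (cfc f V (b k)) = halfSign j * halfSign k * fhat f (j - k) := by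
    rw [hb j, hb k, map_smul, inner_smul_left, inner_smul_right,
      inner_cfc_of_shift hf hVu c.orthonormal hV, conj_halfSign]
    ring
  rw [sub_apply, inner_sub_right, inner_cfc_of_shift hf hUu b.orthonormal hU, h2]
  ring

end Shifts

section Besov

open MeasureTheory

lemma AdmissibleWeight.circW_eq_sum {w : ℝ → ℝ} (hw : AdmissibleWeight w) (m : ℕ) (z : ℂ) :
    circW w (m + 1) z =
      ∑ l ∈ Finset.range (2 ^ (m + 2)), (w ((l : ℝ) / 2 ^ (m + 1)) : ℂ) * z ^ l := by
  rw [circW, if_neg m.succ_ne_zero,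
    tsum_eq_sum (s := (Finset.range (2 ^ (m + 2))).map Nat.castEmbedding)]
  · rw [Finset.sum_map]
    refine Finset.sum_congr rfl fun l _ => ?_
    simp
  · intro k hk
    have hw0 : w ((k : ℝ) / 2 ^ (m + 1)) = 0 := by
      rcases lt_or_ge k 0 with hk0 | hk0
      · refine hw.eq_zero_of_le ((div_nonpos_of_nonpos_of_nonneg ?_ (by positivity)).trans
          (by norm_num))
        exact_mod_cast hk0.le
      · lift k to ℕ using hk0
        have hk2 : 2 ^ (m + 2) ≤ k := by
          by_contra h
          exact hk (Finset.mem_map.2 ⟨k, Finset.mem_range.2 (not_le.1 h), rfl⟩)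
        rw [Int.cast_natCast]
        exact hw.eq_zero_of_nat_ge hk2
    rw [hw0]
    simp

lemma circConv_sum_zpow {f : ℂ → ℂ} (hf : ContinuousOn f (Metric.sphere (0 : ℂ) 1))
    (N : Finset ℕ) (a : ℕ → ℂ) (σ : ℕ → ℤ) (ζ : ℂ) {g : ℂ → ℂ}
    (hg : ∀ t, g (ζ * (ept t)⁻¹) = ∑ l ∈ N, a l * (ζ * (ept t)⁻¹) ^ σ l) :
    circConv f g ζ = ∑ l ∈ N, a l * fhat f (σ l) * ζ ^ σ l := by
  have hintegrable : ∀ l ∈ N, IntervalIntegrable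
      (fun t => a l * ζ ^ σ l * (f (ept t) * (ept t ^ σ l)⁻¹)) volume 0 (2 * Real.pi) := fun l _ =>
    (continuous_const.mul ((continuous_comp_ept hf).mul
      (continuous_inv_ept_zpow (σ l)))).intervalIntegrable _ _
  have h : ∀ t, f (ept t) * g (ζ * (ept t)⁻¹) =
      ∑ l ∈ N, a l * ζ ^ σ l * (f (ept t) * (ept t ^ σ l)⁻¹) := by
    intro t
    rw [hg, Finset.mul_sum]
    refine Finset.sum_congr rfl fun l _ => ?_
    rw [mul_zpow, inv_zpow]
    ring
  rw [circConv]
  simp_rw [h]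
  rw [intervalIntegral.integral_finsetSum hintegrable, Finset.smul_sum]
  refine Finset.sum_congr rfl fun l _ => ?_
  rw [intervalIntegral.integral_const_mul, ← mul_smul_comm, ← fhat]
  ring

lemma circConv_circW {w : ℝ → ℝ} (hw : AdmissibleWeight w) {f : ℂ → ℂ}
    (hf : ContinuousOn f (Metric.sphere (0 : ℂ) 1)) (m : ℕ) (ζ : ℂ) :
    circConv f (circW w (m + 1)) ζ = dyadicPiece w (fun l => fhat f l) (m + 1) ζ := by
  rw [circConv_sum_zpow hf (Finset.range (2 ^ (m + 2)))
    (fun l => (w ((l : ℝ) / 2 ^ (m + 1)) : ℂ)) (fun l => (l : ℤ)) ζ fun t => by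
      simp_rw [hw.circW_eq_sum, zpow_natCast], dyadicPiece]
  simp_rw [zpow_natCast]

lemma circConv_circWs {w : ℝ → ℝ} (hw : AdmissibleWeight w) {f : ℂ → ℂ}
    (hf : ContinuousOn f (Metric.sphere (0 : ℂ) 1)) (m : ℕ) (t : ℝ) :
    circConv f (circWs w (m + 1)) (ept t) =
      dyadicPiece w (fun l => fhat f (-l)) (m + 1) (ept (-t)) := by
  rw [circConv_sum_zpow hf (Finset.range (2 ^ (m + 2)))
    (fun l => (w ((l : ℝ) / 2 ^ (m + 1)) : ℂ)) (fun l => -(l : ℤ)) (ept t) fun s => ?_,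
    dyadicPiece]
  · simp_rw [zpow_neg, zpow_natCast, ← inv_ept, inv_pow]
  · have hconj : (starRingEnd ℂ) (ept t * (ept s)⁻¹) = (ept t * (ept s)⁻¹)⁻¹ := by
      refine (Complex.inv_eq_conj ?_).symm
      rw [norm_mul, norm_inv, norm_ept, norm_ept, inv_one, mul_one]
    rw [circWs, hw.circW_eq_sum, map_sum]
    refine Finset.sum_congr rfl fun l _ => ?_
    rw [map_mul, map_pow, hconj, Complex.conj_ofReal, zpow_neg, zpow_natCast, inv_pow]

lemma integral_comp_ept_neg (g : ℂ → ℝ) :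
    ∫ t in (0 : ℝ)..(2 * Real.pi), g (ept (-t)) = ∫ t in (0 : ℝ)..(2 * Real.pi), g (ept t) := by
  have hper : Function.Periodic (fun t => g (ept t)) (2 * Real.pi) := by
    intro t
    simp only [ept_add, ept_two_pi, mul_one]
  rw [intervalIntegral.integral_comp_neg fun t => g (ept t)]
  have h := hper.intervalIntegral_add_eq (-(2 * Real.pi)) 0
  simpa using h

lemma pieceMass_two_mul (w : ℝ → ℝ) (γ : ℕ → ℂ) (p : ℝ) (m : ℕ) :
    pieceMass w (fun l => 2 * γ l) p m = 2 ^ p * pieceMass w γ p m := by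
  have h : ∀ z, dyadicPiece w (fun l => 2 * γ l) m z = 2 * dyadicPiece w γ m z := by
    intro z
    rw [dyadicPiece, dyadicPiece, Finset.mul_sum]
    exact Finset.sum_congr rfl fun l _ => by ring
  simp_rw [pieceMass, h, norm_mul, Real.mul_rpow (norm_nonneg _) (norm_nonneg _)]
  rw [intervalIntegral.integral_const_mul]
  simp only [Complex.norm_ofNat]
  ring

lemma Summable.of_pieceMass_two_mul {w : ℝ → ℝ} {γ : ℕ → ℂ} {p : ℝ}
    (h : Summable (pieceMass w (fun l => 2 * γ l) p)) : Summable (pieceMass w γ p) := by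
  have h2 : (2 : ℝ) ^ p ≠ 0 := by positivity
  refine (summable_mul_left_iff h2).1 ?_
  simpa only [← pieceMass_two_mul] using h

lemma summable_pieceMass_fhat {p : ℝ} (hp0 : 0 < p) {f : ℂ → ℂ}
    (hf : ContinuousOn f (Metric.sphere (0 : ℂ) 1))
    (hyp : ∀ (H : Type) [NormedAddCommGroup H] [InnerProductSpace ℂ H] [CompleteSpace H]
      [TopologicalSpace.SeparableSpace H], ∀ U V : H →L[ℂ] H,
      U ∈ unitary (H →L[ℂ] H) → V ∈ unitary (H →L[ℂ] H) →
      LinearMap.rank ((U - V : H →L[ℂ] H) : H →ₗ[ℂ] H) = 1 → MemSchatten p (cfc f U - cfc f V))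
    {w : ℝ → ℝ} (hw : AdmissibleWeight w) :
    Summable (pieceMass w (fun l => fhat f l) p) ∧
      Summable (pieceMass w (fun l => fhat f (-l)) p) := by
  let b : HilbertBasis ℤ ℂ (lp (fun _ : ℤ => ℂ) 2) := default
  have := b.separableSpace
  obtain ⟨c, hc⟩ := b.exists_halfSign_smul
  obtain ⟨U, hUu, hU⟩ := b.exists_unitary_shift
  obtain ⟨V, hVu, hV⟩ := c.exists_unitary_shift
  have hT := hyp _ U V hUu hVu (rank_shift_sub_signed_shift b c hc hU hV)
  have hinner := inner_cfc_sub_cfc_of_shifts hf b c hc hUu hVu hU hV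
  have hpos : Orthonormal ℂ fun j : ℕ => b (j : ℤ) :=
    b.orthonormal.comp (fun j : ℕ => (j : ℤ)) Nat.cast_injective
  have hneg : Orthonormal ℂ fun j : ℕ => b (-(j : ℤ)) :=
    b.orthonormal.comp (fun j : ℕ => -(j : ℤ)) (neg_injective.comp Nat.cast_injective)
  have hsign : ∀ {k : ℕ}, 1 ≤ k → halfSign (-(k : ℤ)) = -1 := fun hk => if_neg (by omega)
  have hsign' : ∀ k : ℕ, halfSign (k : ℤ) = 1 := fun k => if_pos (by omega)
  constructor <;> refine Summable.of_pieceMass_two_mul ?_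
  · refine summable_pieceMass hw hp0 _ hT hpos hneg fun j k _ hk => ?_
    rw [hinner, hsign hk, hsign']
    push_cast
    rw [sub_neg_eq_add]
    ring
  · refine summable_pieceMass hw hp0 _ hT hneg hpos fun j k hj _ => ?_
    rw [hinner, hsign hj, hsign']
    push_cast
    rw [neg_add']
    ring

lemma circLpP_circConv_circW {w : ℝ → ℝ} (hw : AdmissibleWeight w) {f : ℂ → ℂ}
    (hf : ContinuousOn f (Metric.sphere (0 : ℂ) 1)) (p : ℝ) (m : ℕ) :
    2 ^ (m + 1) * circLpP p (circConv f (circW w (m + 1))) =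
      (2 * Real.pi)⁻¹ * pieceMass w (fun l => fhat f l) p (m + 1) := by
  simp_rw [circLpP, circConv_circW hw hf, pieceMass]
  ring

lemma circLpP_circConv_circWs {w : ℝ → ℝ} (hw : AdmissibleWeight w) {f : ℂ → ℂ}
    (hf : ContinuousOn f (Metric.sphere (0 : ℂ) 1)) (p : ℝ) (m : ℕ) :
    2 ^ (m + 1) * circLpP p (circConv f (circWs w (m + 1))) =
      (2 * Real.pi)⁻¹ * pieceMass w (fun l => fhat f (-l)) p (m + 1) := by
  simp_rw [circLpP, circConv_circWs hw hf, pieceMass]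
  rw [integral_comp_ept_neg fun z => ‖dyadicPiece w (fun l => fhat f (-l)) (m + 1) z‖ ^ p]
  ring

end Besov

theorem stmt11 (p : ℝ) (hp0 : 0 < p) (f : ℂ → ℂ)
    (hf : ContinuousOn f (Metric.sphere (0 : ℂ) 1))
    (hyp : ∀ (H : Type) [NormedAddCommGroup H] [InnerProductSpace ℂ H] [CompleteSpace H]
      [TopologicalSpace.SeparableSpace H],
      ∀ U V : H →L[ℂ] H, U ∈ unitary (H →L[ℂ] H) → V ∈ unitary (H →L[ℂ] H) →
        LinearMap.rank ((U - V : H →L[ℂ] H) : H →ₗ[ℂ] H) = 1 →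
        MemSchatten p (cfc f U - cfc f V)) :
    ∀ w : ℝ → ℝ, AdmissibleWeight w →
      Summable fun n : ℕ =>
        (2 : ℝ) ^ (((n : ℝ) + 1) * (1 / p) * p) *
          (circLpP p (circConv f (circW w (n + 1))) +
            circLpP p (circConv f (circWs w (n + 1)))) := by
  intro w hw
  obtain ⟨h1, h2⟩ := summable_pieceMass_fhat hp0 hf hyp hw
  have h := (((summable_nat_add_iff 1).2 h1).add ((summable_nat_add_iff 1).2 h2)).mul_left
    (2 * Real.pi)⁻¹
  refine h.congr fun n => ?_
  have he : (2 : ℝ) ^ (((n : ℝ) + 1) * (1 / p) * p) = 2 ^ (n + 1) := by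
    rw [mul_assoc, one_div, inv_mul_cancel₀ hp0.ne', mul_one, ← Real.rpow_natCast]
    push_cast
    rfl
  rw [he, mul_add, mul_add, circLpP_circConv_circW hw hf, circLpP_circConv_circWs hw hf]
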